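/- arXiv:2203.03264 — 3 statements merged into one kernel-verified Lean document; each statement's English description precedes it below -/
import Mathlib

section
/- Let φ, ρ be weights on (0,1) with φ, ρ > 0 on (0,1), ρ Lipschitz on (0,1), φ ∈ C(0,1) ∩ L^∞(0,1), and 1/φ ∈ L^∞_loc(0,1). If f ∈ L²_φ(0,1), then the weighted ROF problem min_{u ∈ L²_φ(0,1)} ∫_0^1 (u(x) − f(x))² φ(x) dx + α TV_ρ(u) has a unique minimizer. -/
open MeasureTheory Set Filter Topology
open scoped ENNReal NNReal

noncomputable section

/-- The weighted total variation `TV_ρ` on `(0,1)`: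
`TV_ρ(u) = sup {∫ u z' : z ∈ C¹_c(0,1), |z| ≤ ρ}`. -/
def TVw (ρ : ℝ → ℝ) (u : ℝ → ℝ) : EReal :=
  sSup ((fun z => ((∫ x in Set.Ioo (0:ℝ) 1, u x * deriv z x : ℝ) : EReal)) ''
    {z : ℝ → ℝ | ContDiff ℝ 1 z ∧ HasCompactSupport z ∧ tsupport z ⊆ Set.Ioo 0 1 ∧
      ∀ x ∈ Set.Ioo (0:ℝ) 1, |z x| ≤ ρ x})

/-- Membership in the weighted Lebesgue space `L²_φ(0,1)`. -/
def MemL2w (φ u : ℝ → ℝ) : Prop :=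
  AEMeasurable u (volume.restrict (Set.Ioo (0:ℝ) 1)) ∧
  IntegrableOn (fun x => u x ^ 2 * φ x) (Set.Ioo (0:ℝ) 1)

/-- Objective of the weighted ROF (denoising) problem `∫ (u-f)² φ + α TV_ρ(u)`. -/
def EROF (φ ρ f : ℝ → ℝ) (α : ℝ) (u : ℝ → ℝ) : EReal :=
  ((∫ x in Set.Ioo (0:ℝ) 1, (u x - f x) ^ 2 * φ x : ℝ) : EReal) + (α : EReal) * TVw ρ u

/-- `u₀` is a minimizer of the weighted ROF problem over `L²_φ(0,1)`. -/
def IsEROFMinimizer (φ ρ f : ℝ → ℝ) (α : ℝ) (u₀ : ℝ → ℝ) : Prop :=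
  MemL2w φ u₀ ∧ ∀ u, MemL2w φ u → EROF φ ρ f α u₀ ≤ EROF φ ρ f α u

/-- Standing assumptions on the weights `φ, ρ` on `(0,1)`: positivity, `ρ` Lipschitz,
`φ` continuous and bounded, `1/φ` locally bounded in `(0,1)`. -/
structure WeightsOK (φ ρ : ℝ → ℝ) : Prop where
  φ_pos : ∀ x ∈ Set.Ioo (0:ℝ) 1, 0 < φ x
  ρ_pos : ∀ x ∈ Set.Ioo (0:ℝ) 1, 0 < ρ x
  ρ_lip : ∃ L : ℝ≥0, LipschitzOnWith L ρ (Set.Ioo (0:ℝ) 1)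
  φ_cont : ContinuousOn φ (Set.Ioo (0:ℝ) 1)
  φ_bdd : ∃ M : ℝ, ∀ x ∈ Set.Ioo (0:ℝ) 1, φ x ≤ M
  inv_φ_loc : ∀ K : Set ℝ, K ⊆ Set.Ioo (0:ℝ) 1 → IsCompact K →
    ∃ c : ℝ, ∀ x ∈ K, 1 / φ x ≤ c

/-- `g` is the derivative of `U` in the sense that `U` is the integral of `g`, with
`g ∈ L²_{1/φ}(0,1)`; this realizes `U ∈ W^{1,2}_{1,1/φ}(0,1)` (continuous
representative). -/
def RepDeriv (φ U g : ℝ → ℝ) : Prop :=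
  IntegrableOn g (Set.Ioo (0:ℝ) 1) ∧
  IntegrableOn (fun x => g x ^ 2 / φ x) (Set.Ioo (0:ℝ) 1) ∧
  ∀ x ∈ Set.Icc (0:ℝ) 1, U x = U 0 + ∫ t in Set.Ioc (0:ℝ) x, g t

/-- Membership in the weighted Sobolev space `W^{1,2}_{1,1/φ}(0,1)`. -/
def MemW (φ U : ℝ → ℝ) : Prop :=
  IntegrableOn (fun x => U x ^ 2) (Set.Ioo (0:ℝ) 1) ∧ ∃ g, RepDeriv φ U g

/-- Lebesgue measure on `(0,1)`. -/
local notation "ν" => Measure.restrict (volume : Measure ℝ) (Set.Ioo (0:ℝ) 1)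

/-- Test functions admissible in the definition of `TVw ρ`. -/
def TVTest (ρ : ℝ → ℝ) : Set (ℝ → ℝ) :=
  {z : ℝ → ℝ | ContDiff ℝ 1 z ∧ HasCompactSupport z ∧ tsupport z ⊆ Set.Ioo 0 1 ∧
      ∀ x ∈ Set.Ioo (0:ℝ) 1, |z x| ≤ ρ x}

theorem zero_mem_TVTest {φ ρ : ℝ → ℝ} (hW : WeightsOK φ ρ) : (0 : ℝ → ℝ) ∈ TVTest ρ := by
  refine ⟨contDiff_const, HasCompactSupport.zero, by simp [tsupport], fun x hx => ?_⟩
  simpa using (hW.ρ_pos x hx).le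

theorem convex_TVTest (ρ : ℝ → ℝ) : Convex ℝ (TVTest ρ) := by
  rintro z ⟨hz1, hz2, hz3, hz4⟩ w ⟨hw1, hw2, hw3, hw4⟩ a b ha hb hab
  refine ⟨(hz1.const_smul a).add (hw1.const_smul b), ?_, ?_, fun x hx => ?_⟩
  · exact (hz2.smul_left (f := fun _ => a)).add (hw2.smul_left (f := fun _ => b))
  · refine (tsupport_add _ _).trans (union_subset ?_ ?_)
    · exact (tsupport_smul_subset_right (fun _ => a) z).trans hz3
    · exact (tsupport_smul_subset_right (fun _ => b) w).trans hw3
  · calc |a * z x + b * w x| ≤ |a * z x| + |b * w x| := abs_add_le _ _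
      _ = a * |z x| + b * |w x| := by rw [abs_mul, abs_mul, abs_of_nonneg ha, abs_of_nonneg hb]
      _ ≤ a * ρ x + b * ρ x := by gcongr <;> [exact hz4 x hx; exact hw4 x hx]
      _ = ρ x := by rw [← add_mul, hab, one_mul]

theorem WeightsOK.aemeasurable_sqrt {φ ρ : ℝ → ℝ} (hW : WeightsOK φ ρ) :
    AEMeasurable (fun x => √(φ x)) ν :=
  (hW.φ_cont.aemeasurable measurableSet_Ioo).sqrt

theorem MemL2w.memLp {φ ρ u : ℝ → ℝ} (hW : WeightsOK φ ρ) (hu : MemL2w φ u) :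
    MemLp (fun x => √(φ x) * u x) 2 ν := by
  have hm : AEMeasurable (fun x => √(φ x) * u x) ν := hW.aemeasurable_sqrt.mul hu.1
  rw [memLp_two_iff_integrable_sq hm.aestronglyMeasurable]
  refine hu.2.congr ?_
  filter_upwards [ae_restrict_mem measurableSet_Ioo] with x hx
  rw [mul_pow, Real.sq_sqrt (hW.φ_pos x hx).le, mul_comm]

theorem memL2w_of_memLp {φ ρ v : ℝ → ℝ} (hW : WeightsOK φ ρ) (hv : MemLp v 2 ν) :
    MemL2w φ (fun x => v x / √(φ x)) := by
  refine ⟨hv.1.aemeasurable.div hW.aemeasurable_sqrt, ?_⟩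
  refine hv.integrable_sq.congr ?_
  filter_upwards [ae_restrict_mem measurableSet_Ioo] with x hx
  have := hW.φ_pos x hx
  rw [div_pow, Real.sq_sqrt this.le]
  field_simp

theorem memLp_deriv_div_sqrt {φ ρ z : ℝ → ℝ} (hW : WeightsOK φ ρ) (hz : z ∈ TVTest ρ) :
    MemLp (fun x => deriv z x / √(φ x)) 2 ν := by
  obtain ⟨h1, h2, h3, -⟩ := hz
  have hc : Continuous (deriv z) := h1.continuous_deriv le_rfl
  obtain ⟨c, hcφ⟩ := hW.inv_φ_loc _ h3 h2
  have hm : AEMeasurable (fun x => deriv z x / √(φ x)) ν :=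
    hc.aemeasurable.div hW.aemeasurable_sqrt
  rw [memLp_two_iff_integrable_sq hm.aestronglyMeasurable]
  have hs : HasCompactSupport (fun x => deriv z x ^ 2) :=
    h2.deriv.comp_left (g := fun t : ℝ => t ^ 2) (by simp)
  have hi : Integrable (fun x => deriv z x ^ 2) volume :=
    (hc.pow 2).integrable_of_hasCompactSupport hs
  refine (hi.restrict.const_mul c).mono' (hm.pow_const 2).aestronglyMeasurable ?_
  filter_upwards [ae_restrict_mem measurableSet_Ioo] with x hx
  have hp := hW.φ_pos x hx
  rw [Real.norm_eq_abs, abs_of_nonneg (sq_nonneg _), div_pow, Real.sq_sqrt hp.le]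
  by_cases hxs : x ∈ tsupport z
  · rw [div_eq_mul_one_div, mul_comm]
    exact mul_le_mul_of_nonneg_right (hcφ x hxs) (sq_nonneg _)
  · have : deriv z x = 0 := by
      by_contra h
      exact hxs (support_deriv_subset h)
    simp [this]

/-- The gradients of test functions, as elements of `L²` after dividing by `√φ`. -/
def TVDual (φ ρ : ℝ → ℝ) : Set (Lp ℝ 2 ν) :=
  {w | ∃ z ∈ TVTest ρ, w =ᵐ[ν] fun x => deriv z x / √(φ x)}

theorem convex_TVDual (φ ρ : ℝ → ℝ) : Convex ℝ (TVDual φ ρ) := by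
  rintro v ⟨y, hy, hv⟩ w ⟨z, hz, hw⟩ a b ha hb hab
  refine ⟨_, convex_TVTest ρ hy hz ha hb hab, ?_⟩
  filter_upwards [hv, hw, Lp.coeFn_add (a • v) (b • w), Lp.coeFn_smul a v, Lp.coeFn_smul b w]
    with x h1 h2 h3 h4 h5
  have hdy : DifferentiableAt ℝ y x := hy.1.differentiable one_ne_zero x
  have hdz : DifferentiableAt ℝ z x := hz.1.differentiable one_ne_zero x
  rw [h3, Pi.add_apply, h4, h5, deriv_add (hdy.const_smul a) (hdz.const_smul b),
    deriv_const_smul a hdy, deriv_const_smul b hdz]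
  simp only [Pi.smul_apply, h1, h2, smul_eq_mul]
  ring

theorem inner_toLp_eq {φ ρ u z : ℝ → ℝ} (hW : WeightsOK φ ρ) (hu : MemL2w φ u)
    {w : Lp ℝ 2 ν} (hw : w =ᵐ[ν] fun x => deriv z x / √(φ x)) :
    inner ℝ w (hu.memLp hW).toLp = ∫ x in Set.Ioo (0:ℝ) 1, u x * deriv z x := by
  rw [L2.inner_def]
  refine integral_congr_ae ?_
  filter_upwards [ae_restrict_mem measurableSet_Ioo, hw, (hu.memLp hW).coeFn_toLp] with x hx h1 h2
  have := Real.sqrt_pos.2 (hW.φ_pos x hx)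
  rw [h1, h2]
  simp only [RCLike.inner_apply, conj_trivial]
  field_simp

theorem norm_toLp_sub_sq {φ ρ u f : ℝ → ℝ} (hW : WeightsOK φ ρ) (hu : MemL2w φ u)
    (hf : MemL2w φ f) :
    ‖(hu.memLp hW).toLp - (hf.memLp hW).toLp‖ ^ 2
      = ∫ x in Set.Ioo (0:ℝ) 1, (u x - f x) ^ 2 * φ x := by
  rw [← real_inner_self_eq_norm_sq, L2.inner_def]
  refine integral_congr_ae ?_
  filter_upwards [ae_restrict_mem measurableSet_Ioo, (hu.memLp hW).coeFn_toLp,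
    (hf.memLp hW).coeFn_toLp, Lp.coeFn_sub (hu.memLp hW).toLp (hf.memLp hW).toLp] with x hx h1 h2 h3
  rw [h3, Pi.sub_apply, h1, h2]
  simp only [RCLike.inner_apply, conj_trivial]
  rw [← mul_sub, mul_mul_mul_comm, Real.mul_self_sqrt (hW.φ_pos x hx).le]
  ring

/-- Moreau decomposition of `f` with respect to the closure of a scaled convex set. -/
theorem exists_moreau_decomposition {H : Type*} [NormedAddCommGroup H] [InnerProductSpace ℝ H]
    [CompleteSpace H] {S : Set H} (hS : Convex ℝ S) (hne : S.Nonempty) {α : ℝ} (hα : 0 < α)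
    (f : H) :
    ∃ p ∈ closure S, ∃ u : H, f = u + (α / 2) • p ∧ ∀ w ∈ S, inner ℝ w u ≤ inner ℝ p u := by
  obtain ⟨p, hp, hmin⟩ := exists_norm_eq_iInf_of_complete_convex hne.closure
    isClosed_closure.isComplete hS.closure ((2 / α) • f)
  rw [norm_eq_iInf_iff_real_inner_le_zero hS.closure hp] at hmin
  refine ⟨p, hp, f - (α / 2) • p, by abel, fun w hw => ?_⟩
  have h := hmin w (subset_closure hw)
  have hfp : f - (α / 2) • p = (α / 2) • ((2 / α) • f - p) := by
    rw [smul_sub, smul_smul, div_mul_div_comm, mul_comm α 2, div_self (by positivity), one_smul]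
  rw [hfp, real_inner_smul_right, real_inner_smul_right]
  rw [real_inner_comm, inner_sub_left] at h
  exact mul_le_mul_of_nonneg_left (by linarith) (by positivity)

theorem norm_sub_sq_add_inner_eq {H : Type*} [NormedAddCommGroup H] [InnerProductSpace ℝ H]
    {α : ℝ} {f u p : H} (hf : f = u + (α / 2) • p) (v : H) :
    ‖v - f‖ ^ 2 + α * inner ℝ p v = ‖u - f‖ ^ 2 + α * inner ℝ p u + ‖v - u‖ ^ 2 := by
  have h1 : v - f = (v - u) - (α / 2) • p := by rw [hf]; abel
  have h2 : u - f = -((α / 2) • p) := by rw [hf]; abel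
  rw [h1, h2, norm_neg, norm_sub_sq_real, real_inner_smul_right, inner_sub_left,
    real_inner_comm p v, real_inner_comm p u]
  ring

theorem TVw_eq (ρ u : ℝ → ℝ) : TVw ρ u = sSup ((fun z : ℝ → ℝ =>
    ((∫ x in Set.Ioo (0:ℝ) 1, u x * deriv z x : ℝ) : EReal)) '' TVTest ρ) := rfl

theorem inner_le_TVw {φ ρ u : ℝ → ℝ} (hW : WeightsOK φ ρ) (hu : MemL2w φ u)
    {p : Lp ℝ 2 ν} (hp : p ∈ closure (TVDual φ ρ)) :
    ((inner ℝ p (hu.memLp hW).toLp : ℝ) : EReal) ≤ TVw ρ u := by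
  have hcl : IsClosed {w : Lp ℝ 2 ν | ((inner ℝ w (hu.memLp hW).toLp : ℝ) : EReal) ≤ TVw ρ u} :=
    isClosed_le (continuous_coe_real_ereal.comp (by fun_prop)) continuous_const
  refine closure_minimal ?_ hcl hp
  rintro w ⟨z, hz, hw⟩
  rw [mem_ofPred_eq, inner_toLp_eq hW hu hw, TVw_eq]
  exact le_sSup ⟨z, hz, rfl⟩

theorem TVw_le_inner {φ ρ u : ℝ → ℝ} (hW : WeightsOK φ ρ) (hu : MemL2w φ u) {c : ℝ}
    (h : ∀ w ∈ TVDual φ ρ, inner ℝ w (hu.memLp hW).toLp ≤ c) : TVw ρ u ≤ c := by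
  rw [TVw_eq]
  refine sSup_le ?_
  rintro _ ⟨z, hz, rfl⟩
  have hw := (memLp_deriv_div_sqrt hW hz).coeFn_toLp
  simpa only [EReal.coe_le_coe_iff, inner_toLp_eq hW hu hw] using h _ ⟨z, hz, hw⟩

/-- well-posedness of the weighted ROF problem.  Let `φ, ρ` be weights
on `(0,1)` with `φ, ρ > 0`, `ρ` Lipschitz, `φ ∈ C(0,1) ∩ L^∞(0,1)`,
`1/φ ∈ L^∞_loc(0,1)`.  If `f ∈ L²_φ(0,1)`, then the weighted ROF problem
`min_{u ∈ L²_φ} ∫ (u-f)² φ + α TV_ρ(u)` has a unique minimizer. -/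
theorem statement_8
    (φ ρ f : ℝ → ℝ) (α : ℝ) (hα : 0 < α)
    (hW : WeightsOK φ ρ) (hf : MemL2w φ f) :
    ∃ u₀, IsEROFMinimizer φ ρ f α u₀ ∧
      ∀ u₁, IsEROFMinimizer φ ρ f α u₁ →
        u₁ =ᵐ[volume.restrict (Set.Ioo (0:ℝ) 1)] u₀ := by
  have hne : (TVDual φ ρ).Nonempty :=
    ⟨_, 0, zero_mem_TVTest hW, (memLp_deriv_div_sqrt hW (zero_mem_TVTest hW)).coeFn_toLp⟩
  obtain ⟨p, hp, v, hfv, hmax⟩ :=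
    exists_moreau_decomposition (convex_TVDual φ ρ) hne hα (hf.memLp hW).toLp
  have hα' : (0 : EReal) ≤ α := by exact_mod_cast hα.le
  have hu₀ : MemL2w φ (fun x => v x / √(φ x)) := memL2w_of_memLp hW (Lp.memLp v)
  have hv : (hu₀.memLp hW).toLp = v := by
    refine Lp.ext ?_
    filter_upwards [ae_restrict_mem measurableSet_Ioo, (hu₀.memLp hW).coeFn_toLp] with x hx h
    rw [h, mul_div_cancel₀ _ (Real.sqrt_pos.2 (hW.φ_pos x hx)).ne']
  have hlower : ∀ u (hu : MemL2w φ u),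
      ((‖v - (hf.memLp hW).toLp‖ ^ 2 + α * inner ℝ p v + ‖(hu.memLp hW).toLp - v‖ ^ 2 : ℝ) : EReal)
        ≤ EROF φ ρ f α u := by
    intro u hu
    rw [← norm_sub_sq_add_inner_eq hfv, norm_toLp_sub_sq hW hu hf, EReal.coe_add, EReal.coe_mul]
    exact add_le_add le_rfl (mul_le_mul_of_nonneg_left (inner_le_TVw hW hu hp) hα')
  have hupper : EROF φ ρ f α (fun x => v x / √(φ x))
      ≤ ((‖v - (hf.memLp hW).toLp‖ ^ 2 + α * inner ℝ p v : ℝ) : EReal) := by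
    have hTV := TVw_le_inner hW hu₀ (c := inner ℝ p v) (by rwa [hv])
    have hn := norm_toLp_sub_sq hW hu₀ hf
    rw [hv] at hn
    rw [hn, EReal.coe_add, EReal.coe_mul]
    exact add_le_add le_rfl (mul_le_mul_of_nonneg_left hTV hα')
  refine ⟨_, ⟨hu₀, fun u hu => hupper.trans (le_trans ?_ (hlower u hu))⟩, ?_⟩
  · exact EReal.coe_le_coe_iff.2 (le_add_of_nonneg_right (sq_nonneg _))
  · rintro u₁ ⟨hu₁, hmin⟩
    have h := EReal.coe_le_coe_iff.1 (((hlower u₁ hu₁).trans (hmin _ hu₀)).trans hupper)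
    have h0 : (hu₁.memLp hW).toLp = v := by
      rw [← sub_eq_zero, ← norm_eq_zero]
      exact pow_eq_zero_iff two_ne_zero |>.1 (le_antisymm (by linarith) (sq_nonneg _))
    have h1 := (hu₁.memLp hW).coeFn_toLp
    rw [h0] at h1
    filter_upwards [ae_restrict_mem measurableSet_Ioo, h1] with x hx h
    rw [h, mul_div_cancel_left₀ _ (Real.sqrt_pos.2 (hW.φ_pos x hx)).ne']
end
end

section
/- Let φ, ρ be weights on (0,1) with φ, ρ > 0 on (0,1), ρ Lipschitz on (0,1), φ ∈ C(0,1) ∩ L^∞(0,1), 1/φ ∈ L^∞_loc(0,1), and let L := {U ∈ W^{1,2}_{1,1/φ,0}(0,1) : |U| ≤ αρ}. Then the closure of L in the strong W^{1,2}_{1,1/φ} topology is contained in its closure in C₀([0,1]) under uniform convergence, and the latter equals {U ∈ C₀([0,1]) : |U| ≤ αρ}. -/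
open MeasureTheory Set Filter Topology
open scoped ENNReal NNReal

noncomputable section

/-- The constraint set `𝓛 = {U ∈ W^{1,2}_{1,1/φ,0}(0,1) : |U| ≤ αρ}`. -/
def InLset (φ ρ : ℝ → ℝ) (α : ℝ) (U : ℝ → ℝ) : Prop :=
  MemW φ U ∧ U 0 = 0 ∧ U 1 = 0 ∧ ∀ x ∈ Set.Ioo (0:ℝ) 1, |U x| ≤ α * ρ x

/-- Membership in the closure of `𝓛` in the strong `W^{1,2}_{1,1/φ}` topology. -/
def InClosureW (φ ρ : ℝ → ℝ) (α : ℝ) (U : ℝ → ℝ) : Prop :=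
  MemW φ U ∧ ∃ (Un : ℕ → ℝ → ℝ) (gn : ℕ → ℝ → ℝ) (g : ℝ → ℝ),
    (∀ n, InLset φ ρ α (Un n)) ∧ (∀ n, RepDeriv φ (Un n) (gn n)) ∧ RepDeriv φ U g ∧
    Filter.Tendsto (fun n =>
        (∫ x in Set.Ioo (0:ℝ) 1, (Un n x - U x) ^ 2) +
        ∫ x in Set.Ioo (0:ℝ) 1, (gn n x - g x) ^ 2 / φ x)
      Filter.atTop (nhds 0)

/-- Membership in the closure of `𝓛` in `C₀([0,1])` under uniform convergence. -/
def InClosureC0 (φ ρ : ℝ → ℝ) (α : ℝ) (U : ℝ → ℝ) : Prop :=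
  ContinuousOn U (Set.Icc (0:ℝ) 1) ∧ U 0 = 0 ∧ U 1 = 0 ∧
  ∃ Un : ℕ → ℝ → ℝ, (∀ n, InLset φ ρ α (Un n)) ∧
    TendstoUniformlyOn (fun n x => Un n x) U Filter.atTop (Set.Icc (0:ℝ) 1)

theorem RepDeriv.continuousOn {φ U g : ℝ → ℝ} (h : RepDeriv φ U g) :
    ContinuousOn U (Icc (0:ℝ) 1) := by
  have hg : IntegrableOn g (Icc (0:ℝ) 1) := by rw [integrableOn_Icc_iff_integrableOn_Ioo]; exact h.1
  exact (continuousOn_const.add (intervalIntegral.continuousOn_primitive hg)).congr h.2.2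

theorem integrableOn_sq_of_continuousOn {U : ℝ → ℝ} (h : ContinuousOn U (Icc (0:ℝ) 1)) :
    IntegrableOn (fun x => U x ^ 2) (Ioo (0:ℝ) 1) :=
  ((h.pow 2).integrableOn_Icc).mono_set Ioo_subset_Icc_self

theorem WeightsOK.integrableOn_sq_sub_div {φ ρ f g : ℝ → ℝ} (hW : WeightsOK φ ρ)
    (hf : IntegrableOn f (Ioo (0:ℝ) 1)) (hg : IntegrableOn g (Ioo (0:ℝ) 1))
    (hf2 : IntegrableOn (fun x => f x ^ 2 / φ x) (Ioo (0:ℝ) 1))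
    (hg2 : IntegrableOn (fun x => g x ^ 2 / φ x) (Ioo (0:ℝ) 1)) :
    IntegrableOn (fun x => (f x - g x) ^ 2 / φ x) (Ioo (0:ℝ) 1) := by
  have hφ := (hW.φ_cont.aemeasurable (μ := volume) measurableSet_Ioo)
  refine Integrable.mono' ((hf2.const_mul 2).add (hg2.const_mul 2))
    (((hf.aemeasurable.sub hg.aemeasurable).pow_const 2).div hφ).aestronglyMeasurable ?_
  filter_upwards [ae_restrict_mem measurableSet_Ioo] with x hx
  have hpos := hW.φ_pos x hx
  rw [Real.norm_of_nonneg (by positivity)]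
  calc (f x - g x) ^ 2 / φ x ≤ (2 * f x ^ 2 + 2 * g x ^ 2) / φ x := by
        gcongr
        nlinarith [sq_nonneg (f x + g x)]
    _ = _ := by
        simp only [Pi.add_apply]
        ring

/-- A Cauchy–Schwarz bound in additive form: `∫ |d| ≤ t⁻¹ ∫ d² / φ + t M` when `φ ≤ M`. -/
theorem WeightsOK.integral_abs_le {φ ρ d : ℝ → ℝ} {M t : ℝ} (hW : WeightsOK φ ρ)
    (hM : ∀ x ∈ Ioo (0:ℝ) 1, φ x ≤ M) (ht : 0 < t) (hd : IntegrableOn d (Ioo (0:ℝ) 1))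
    (hd2 : IntegrableOn (fun x => d x ^ 2 / φ x) (Ioo (0:ℝ) 1)) :
    ∫ x in Ioo (0:ℝ) 1, |d x| ≤ t⁻¹ * (∫ x in Ioo (0:ℝ) 1, d x ^ 2 / φ x) + t * M := by
  have hc : IntegrableOn (fun _ : ℝ => t * M) (Ioo (0:ℝ) 1) :=
    integrableOn_const measure_Ioo_lt_top.ne
  calc ∫ x in Ioo (0:ℝ) 1, |d x|
      ≤ ∫ x in Ioo (0:ℝ) 1, (t⁻¹ * (d x ^ 2 / φ x) + t * M) := by
        refine setIntegral_mono_on hd.abs ((hd2.const_mul _).add hc) measurableSet_Ioo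
          fun x hx => ?_
        have hpos := hW.φ_pos x hx
        have h1 : |d x| ≤ t⁻¹ * (d x ^ 2 / φ x) + t * φ x := by
          have h2 : t⁻¹ * (d x ^ 2 / φ x) + t * φ x - |d x|
              = ((|d x| - t * φ x) ^ 2 + |d x| * (t * φ x)) / (t * φ x) := by
            rw [← sq_abs (d x)]
            field_simp
            ring
          have h3 : 0 ≤ ((|d x| - t * φ x) ^ 2 + |d x| * (t * φ x)) / (t * φ x) := by
            positivity
          linarith
        have := mul_le_mul_of_nonneg_left (hM x hx) ht.le
        linarith
    _ = _ := by
        rw [integral_add (hd2.const_mul _) hc, integral_const_mul]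
        simp

theorem RepDeriv.abs_sub_le {φ U V f g : ℝ → ℝ} (hU : RepDeriv φ U f) (hV : RepDeriv φ V g)
    {x : ℝ} (hx : x ∈ Icc (0:ℝ) 1) :
    |(U x - U 0) - (V x - V 0)| ≤ ∫ t in Ioo (0:ℝ) 1, |f t - g t| := by
  have hf : IntegrableOn f (Ioc (0:ℝ) 1) := by rw [integrableOn_Ioc_iff_integrableOn_Ioo]; exact hU.1
  have hg : IntegrableOn g (Ioc (0:ℝ) 1) := by rw [integrableOn_Ioc_iff_integrableOn_Ioo]; exact hV.1
  have hs : Ioc 0 x ⊆ Ioc (0:ℝ) 1 := Ioc_subset_Ioc_right hx.2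
  have h1 : (U x - U 0) - (V x - V 0) = ∫ t in Ioc 0 x, (f t - g t) := by
    rw [integral_sub (hf.mono_set hs) (hg.mono_set hs), hU.2.2 x hx, hV.2.2 x hx]
    ring
  rw [h1, ← integral_Ioc_eq_integral_Ioo]
  refine (abs_integral_le_integral_abs).trans ?_
  exact setIntegral_mono_set (hf.sub hg).abs (ae_of_all _ fun _ => abs_nonneg _)
    (LE.le.eventuallyLE hs)

theorem InClosureW.inClosureC0 {φ ρ U : ℝ → ℝ} {α : ℝ} (hW : WeightsOK φ ρ)
    (h : InClosureW φ ρ α U) : InClosureC0 φ ρ α U := by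
  obtain ⟨-, Un, gn, g, hL, hgn, hg, hlim⟩ := h
  obtain ⟨M, hM⟩ := hW.φ_bdd
  have hM0 : 0 < M :=
    (hW.φ_pos (1 / 2) (by norm_num)).trans_le (hM (1 / 2) (by norm_num))
  have hnn1 : ∀ n, 0 ≤ ∫ x in Ioo (0:ℝ) 1, (Un n x - U x) ^ 2 := fun n =>
    integral_nonneg fun x => sq_nonneg _
  have hnn2 : ∀ n, 0 ≤ ∫ x in Ioo (0:ℝ) 1, (gn n x - g x) ^ 2 / φ x := fun n =>
    setIntegral_nonneg measurableSet_Ioo fun x hx =>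
      div_nonneg (sq_nonneg _) (hW.φ_pos x hx).le
  have key : ∀ ε > 0, ∀ᶠ n in atTop, (∫ x in Ioo (0:ℝ) 1, (Un n x - U x) ^ 2) < ε ^ 2 ∧
      ∀ x ∈ Icc (0:ℝ) 1, |Un n x - (U x - U 0)| < ε := by
    intro ε hε
    have ht : 0 < ε / (2 * M) := by positivity
    filter_upwards [hlim.eventually (gt_mem_nhds (show 0 < ε ^ 2 by positivity)),
      hlim.eventually (gt_mem_nhds (show 0 < ε / (2 * M) * (ε / 2) by positivity))] with n h1 h2
    refine ⟨by linarith [hnn2 n], fun x hx => ?_⟩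
    have h3 := (hgn n).abs_sub_le hg hx
    have h4 := hW.integral_abs_le hM ht ((hgn n).1.sub hg.1)
      (hW.integrableOn_sq_sub_div (hgn n).1 hg.1 (hgn n).2.1 hg.2.1)
    rw [(hL n).2.1, sub_zero] at h3
    refine (h3.trans h4).trans_lt ?_
    have h5 : ∫ x in Ioo (0:ℝ) 1, (gn n x - g x) ^ 2 / φ x < ε / (2 * M) * (ε / 2) := by
      linarith [hnn1 n]
    have h6 : ε / (2 * M) * M = ε / 2 := by field_simp
    have h7 : (ε / (2 * M))⁻¹ * (∫ x in Ioo (0:ℝ) 1, (gn n x - g x) ^ 2 / φ x) < ε / 2 := by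
      rwa [inv_mul_lt_iff₀ ht]
    simp only [Pi.sub_apply] at *
    linarith
  have hU0 : U 0 = 0 := by
    rw [← abs_nonpos_iff]
    refine le_of_forall_pos_le_add fun ε hε => ?_
    obtain ⟨n, h1, h2⟩ := (key (ε / 2) (by positivity)).exists
    have hsq : IntegrableOn (fun x => (Un n x - U x) ^ 2) (Ioo (0:ℝ) 1) :=
      integrableOn_sq_of_continuousOn ((hgn n).continuousOn.sub hg.continuousOn)
    have hc : ∀ c : ℝ, IntegrableOn (fun _ : ℝ => c) (Ioo (0:ℝ) 1) := fun c =>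
      integrableOn_const measure_Ioo_lt_top.ne
    have h3 : ∫ _ in Ioo (0:ℝ) 1, U 0 ^ 2
        ≤ ∫ x in Ioo (0:ℝ) 1, (2 * (Un n x - U x) ^ 2 + 2 * (ε / 2) ^ 2) := by
      refine setIntegral_mono_on (hc _) ((hsq.const_mul 2).add (hc _)) measurableSet_Ioo
        fun x hx => ?_
      have h4 := sq_lt_sq' (abs_lt.1 (h2 x (Ioo_subset_Icc_self hx))).1
        (abs_lt.1 (h2 x (Ioo_subset_Icc_self hx))).2
      nlinarith [sq_nonneg ((Un n x - U x) + (Un n x - (U x - U 0)))]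
    rw [integral_add (hsq.const_mul 2) (hc _), integral_const_mul] at h3
    simp only [setIntegral_const, Real.volume_real_Ioo, sub_zero, smul_eq_mul,
      max_eq_left zero_le_one, one_mul] at h3
    rw [zero_add]
    exact abs_le_of_sq_le_sq (by nlinarith) hε.le
  have hunif : TendstoUniformlyOn (fun n x => Un n x) U atTop (Icc (0:ℝ) 1) := by
    rw [Metric.tendstoUniformlyOn_iff]
    intro ε hε
    filter_upwards [key ε hε] with n hn x hx
    rw [dist_comm, Real.dist_eq]
    simpa [hU0] using hn.2 x hx
  refine ⟨hg.continuousOn, hU0, ?_, Un, hL, hunif⟩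
  have h1 := hunif.tendsto_at (right_mem_Icc.2 zero_le_one)
  simp only [(hL _).2.2.1] at h1
  exact tendsto_nhds_unique h1 tendsto_const_nhds

theorem WeightsOK.memW_of_lipschitzOnWith {φ ρ W : ℝ → ℝ} {C : ℝ≥0} {K : Set ℝ}
    (hW : WeightsOK φ ρ) (hlip : LipschitzOnWith C W (Icc (0:ℝ) 1)) (hK : IsCompact K)
    (hK01 : K ⊆ Ioo 0 1) (hzero : ∀ x ∈ Ioo (0:ℝ) 1, x ∉ K → W x = 0) : MemW φ W := by
  refine ⟨integrableOn_sq_of_continuousOn hlip.continuousOn, deriv W, ?_, ?_, ?_⟩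
  · refine Measure.integrableOn_of_bounded (M := C) measure_Ioo_lt_top.ne
      (aestronglyMeasurable_deriv _ _) ?_
    filter_upwards [ae_restrict_mem measurableSet_Ioo] with x hx
    exact norm_deriv_le_of_lipschitzOn (Icc_mem_nhds hx.1 hx.2) hlip
  · obtain ⟨c, hc⟩ := hW.inv_φ_loc K hK01 hK
    have hφ := (hW.φ_cont.aemeasurable (μ := volume) measurableSet_Ioo)
    refine Integrable.of_bound (C := C ^ 2 * max c 0)
      (((measurable_deriv W).aemeasurable.pow_const 2).div hφ).aestronglyMeasurable ?_
    filter_upwards [ae_restrict_mem measurableSet_Ioo] with x hx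
    have hpos := hW.φ_pos x hx
    by_cases hxK : x ∈ K
    · have h1 := norm_deriv_le_of_lipschitzOn (Icc_mem_nhds hx.1 hx.2) hlip
      rw [Real.norm_of_nonneg (by positivity), div_eq_mul_one_div, ← sq_abs]
      exact mul_le_mul (pow_le_pow_left₀ (abs_nonneg _) h1 2)
        ((hc x hxK).trans (le_max_left _ _)) (by positivity) (by positivity)
    · have h1 : W =ᶠ[𝓝 x] fun _ => 0 := by
        filter_upwards [isOpen_Ioo.mem_nhds hx, hK.isClosed.isOpen_compl.mem_nhds hxK]
          with y hy hyK using hzero y hy hyK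
      rw [h1.deriv_eq]
      simp only [deriv_const, ne_eq, OfNat.ofNat_ne_zero, not_false_eq_true, zero_pow, zero_div,
        norm_zero]
      positivity
  · intro x hx
    have hac : AbsolutelyContinuousOnInterval W 0 x := by
      refine LipschitzOnWith.absolutelyContinuousOnInterval (K := C) (hlip.mono ?_)
      rw [uIcc_of_le hx.1]
      exact Icc_subset_Icc_right hx.2
    have h1 := hac.integral_deriv_eq_sub
    rw [intervalIntegral.integral_of_le hx.1] at h1
    linarith

theorem WeightsOK.exists_inLset_near {φ ρ U : ℝ → ℝ} {α ε : ℝ} (hW : WeightsOK φ ρ)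
    (hc : ContinuousOn U (Icc (0:ℝ) 1)) (h0 : U 0 = 0) (h1 : U 1 = 0)
    (hU : ∀ x ∈ Ioo (0:ℝ) 1, |U x| ≤ α * ρ x) (hε : 0 < ε) :
    ∃ W, InLset φ ρ α W ∧ ∀ x ∈ Icc (0:ℝ) 1, |W x - U x| ≤ 3 * ε := by
  obtain ⟨p, hp⟩ := exists_polynomial_near_of_continuousOn 0 1 U hc ε hε
  obtain ⟨C, hC⟩ := (p.contDiff_aeval (𝕜 := ℝ) 1).contDiffOn.exists_lipschitzOnWith one_ne_zero
    (convex_Icc (0:ℝ) 1) isCompact_Icc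
  let W : ℝ → ℝ := fun x => max (p.eval x - 2 * ε) 0 - max (-p.eval x - 2 * ε) 0
  have hWsmall : ∀ x ∈ Icc (0:ℝ) 1, |U x| < ε → W x = 0 := by
    intro x hx hx'
    have := abs_lt.1 (hp x hx)
    have := abs_lt.1 hx'
    simp only [W]
    rw [max_eq_right (by linarith), max_eq_right (by linarith), sub_zero]
  have hWU : ∀ x ∈ Icc (0:ℝ) 1, |W x| ≤ |U x| := by
    intro x hx
    have := abs_lt.1 (hp x hx)
    simp only [W]
    grind
  have hWn : ∀ x ∈ Icc (0:ℝ) 1, |W x - U x| ≤ 3 * ε := by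
    intro x hx
    have := abs_lt.1 (hp x hx)
    simp only [W]
    grind
  have hlip : LipschitzOnWith C W (Icc (0:ℝ) 1) := by
    have e : ∀ x y : ℝ, |W x - W y| ≤ |p.eval x - p.eval y| := by
      intro x y
      simp only [W]
      grind
    refine LipschitzOnWith.of_dist_le_mul fun x hx y hy => ?_
    exact (e x y).trans (hC.dist_le_mul x hx y hy)
  let K : Set ℝ := Icc 0 1 ∩ (fun x => |U x|) ⁻¹' Ici ε
  have hK : IsCompact K := isCompact_Icc.of_isClosed_subset
    (hc.abs.preimage_isClosed_of_isClosed isClosed_Icc isClosed_Ici) inter_subset_left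
  have hK01 : K ⊆ Ioo 0 1 := by
    rintro x ⟨hx, hxε⟩
    have hne : U x ≠ 0 := abs_pos.1 (hε.trans_le hxε)
    exact ⟨lt_of_le_of_ne hx.1 (by rintro rfl; exact hne h0),
      lt_of_le_of_ne hx.2 (by rintro rfl; exact hne h1)⟩
  refine ⟨W, ⟨hW.memW_of_lipschitzOnWith hlip hK hK01 fun x hx hxK => ?_, ?_, ?_, ?_⟩, hWn⟩
  · have hx' := Ioo_subset_Icc_self hx
    exact hWsmall x hx' (not_le.1 fun h => hxK ⟨hx', h⟩)
  · exact hWsmall 0 (by simp) (by simpa [h0])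
  · exact hWsmall 1 (by simp) (by simpa [h1])
  · exact fun x hx => (hWU x (Ioo_subset_Icc_self hx)).trans (hU x hx)

/-- Lemma `phiclosure`.  The closure of
`𝓛 = {U ∈ W^{1,2}_{1,1/φ,0}(0,1) : |U| ≤ αρ}` in the strong `W^{1,2}_{1,1/φ}` topology is
contained in its closure in `C₀([0,1])` under uniform convergence, and the latter equals
`{U ∈ C₀([0,1]) : |U| ≤ αρ}`. -/
theorem statement_11
    (φ ρ : ℝ → ℝ) (α : ℝ) (hα : 0 < α) (hW : WeightsOK φ ρ) :
    (∀ U : ℝ → ℝ, InClosureW φ ρ α U → InClosureC0 φ ρ α U) ∧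
    (∀ U : ℝ → ℝ, InClosureC0 φ ρ α U ↔
      (ContinuousOn U (Set.Icc (0:ℝ) 1) ∧ U 0 = 0 ∧ U 1 = 0 ∧
        ∀ x ∈ Set.Ioo (0:ℝ) 1, |U x| ≤ α * ρ x)) := by
  refine ⟨fun U hU => hU.inClosureC0 hW, fun U => ⟨?_, ?_⟩⟩
  · rintro ⟨hc, h0, h1, Un, hL, hlim⟩
    refine ⟨hc, h0, h1, fun x hx => ?_⟩
    exact le_of_tendsto (hlim.tendsto_at (Ioo_subset_Icc_self hx)).abs
      (Eventually.of_forall fun n => (hL n).2.2.2 x hx)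
  · rintro ⟨hc, h0, h1, hU⟩
    choose Un hL hUn using fun n : ℕ =>
      hW.exists_inLset_near hc h0 h1 hU (Nat.one_div_pos_of_nat (α := ℝ) (n := n))
    refine ⟨hc, h0, h1, Un, hL, ?_⟩
    rw [Metric.tendstoUniformlyOn_iff]
    intro ε hε
    have hlim := (tendsto_one_div_add_atTop_nhds_zero_nat (𝕜 := ℝ)).const_mul 3
    rw [mul_zero] at hlim
    filter_upwards [hlim.eventually (gt_mem_nhds hε)] with n hn x hx
    rw [dist_comm, Real.dist_eq]
    exact (hUn n x hx).trans_lt hn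
end
end

section
/- Let f: (0,1) → ℝ with f restricted to (δ,1) in L²(δ,1) for every δ ∈ (0,1), and suppose f(r) = r^{−β} for all r ∈ (0,δ₀) for some δ₀ ∈ (0,1), with 2β < d so that f ∈ L²_{r^{d−1}}(0,1). Let u be the minimizer of the weighted ROF problem with weights ρ(r) = φ(r) = r^{d−1}. Then: if u is unbounded on every neighborhood of 0, necessarily β ≥ 1; if β > 1, then u is unbounded on every neighborhood of 0; and if d = 2, then u is always bounded on a neighborhood of 0. -/
open MeasureTheory Set Filter Topology
open scoped ENNReal NNReal

noncomputable section

/-- The fields admissible in the definition of `TVw`. -/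
def admissibleFields (ρ : ℝ → ℝ) : Set (ℝ → ℝ) :=
  {z : ℝ → ℝ | ContDiff ℝ 1 z ∧ HasCompactSupport z ∧ tsupport z ⊆ Set.Ioo 0 1 ∧
      ∀ x ∈ Set.Ioo (0:ℝ) 1, |z x| ≤ ρ x}

lemma TVw_le_iff {ρ u : ℝ → ℝ} {T : ℝ} :
    TVw ρ u ≤ T ↔ ∀ z ∈ admissibleFields ρ, ∫ x in Ioo (0:ℝ) 1, u x * deriv z x ≤ T := by
  rw [TVw, sSup_le_iff, forall_mem_image]
  simp only [EReal.coe_le_coe_iff]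
  rfl

lemma TVw_nonneg {ρ : ℝ → ℝ} (hρ : ∀ x ∈ Ioo (0:ℝ) 1, 0 ≤ ρ x) (u : ℝ → ℝ) : 0 ≤ TVw ρ u := by
  refine le_sSup ⟨fun _ => 0, ⟨contDiff_const, HasCompactSupport.zero, ?_, ?_⟩, ?_⟩
  · have : tsupport (fun _ : ℝ => (0:ℝ)) = ∅ := tsupport_eq_empty_iff.2 rfl
    simp [this]
  · simpa using hρ
  · simp

/-- A minimizer has finite total variation, and its minimality can be stated over the reals. -/
lemma IsEROFMinimizer.exists_real {φ ρ f u : ℝ → ℝ} {α : ℝ} (hα : 0 < α)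
    (hρ : ∀ x ∈ Ioo (0:ℝ) 1, 0 ≤ ρ x) (hu : IsEROFMinimizer φ ρ f α u) :
    ∃ T : ℝ, (∀ z ∈ admissibleFields ρ, ∫ x in Ioo (0:ℝ) 1, u x * deriv z x ≤ T) ∧
      ∀ v T', MemL2w φ v →
        (∀ z ∈ admissibleFields ρ, ∫ x in Ioo (0:ℝ) 1, v x * deriv z x ≤ T') →
        (∫ x in Ioo (0:ℝ) 1, (u x - f x) ^ 2 * φ x) + α * T ≤
          (∫ x in Ioo (0:ℝ) 1, (v x - f x) ^ 2 * φ x) + α * T' := by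
  have key : ∀ v (T' : ℝ), MemL2w φ v → TVw ρ v ≤ T' →
      EROF φ ρ f α u ≤ (((∫ x in Ioo (0:ℝ) 1, (v x - f x) ^ 2 * φ x) + α * T' : ℝ) : EReal) := by
    intro v T' hv hT'
    refine (hu.2 v hv).trans ?_
    rw [EROF, EReal.coe_add, EReal.coe_mul]
    gcongr
  have h0 : MemL2w φ (fun _ => 0) := ⟨aemeasurable_const, by simp⟩
  have hTV0 : TVw ρ (fun _ => 0) ≤ (0:ℝ) := TVw_le_iff.2 (by simp)
  have hfin : TVw ρ u ≠ ⊤ := by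
    intro h
    have h1 := key _ 0 h0 hTV0
    rw [EROF, h, EReal.coe_mul_top_of_pos hα, EReal.coe_add_top] at h1
    exact absurd h1 (not_le.2 (EReal.coe_lt_top _))
  have hbot : TVw ρ u ≠ ⊥ := fun h => by
    have := TVw_nonneg hρ u
    rw [h] at this
    exact absurd this (by simp)
  lift TVw ρ u to ℝ using ⟨hfin, hbot⟩ with T hT
  refine ⟨T, TVw_le_iff.1 hT.ge, fun v T' hv hT' => ?_⟩
  have := key v T' hv (TVw_le_iff.2 hT')
  rw [EROF, ← hT] at this
  exact_mod_cast this

/-- Continuous fields bounded by an increasing weight, vanishing at `0` and near `1`, may be used to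
bound the total variation from below. -/
lemma integral_mul_le_of_continuous_field {ρ u W g G : ℝ → ℝ} {T b : ℝ}
    (hT : ∀ z ∈ admissibleFields ρ, ∫ x in Ioo (0:ℝ) 1, u x * deriv z x ≤ T)
    (hρ : MonotoneOn ρ (Ioo (0:ℝ) 1))
    (hu : AEMeasurable u (volume.restrict (Ioo (0:ℝ) 1)))
    (hW : Continuous W) (hb : b < 1) (hW0 : ∀ x ≤ 0, W x = 0) (hWb : ∀ x, b ≤ x → W x = 0)
    (hWρ : ∀ x ∈ Ioo (0:ℝ) 1, |W x| ≤ ρ x)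
    (hG : ∀ w ∈ Ioo (0:ℝ) 1, ∀ x y, x ≤ y → y ≤ w → |W y - W x| ≤ G w * (y - x))
    (hGi : IntegrableOn (fun x => u x * G x) (Ioo (0:ℝ) 1))
    (hg : ∀ᵐ x ∂(volume.restrict (Ioo (0:ℝ) 1)), HasDerivAt W (g x) x) :
    ∫ x in Ioo (0:ℝ) 1, u x * g x ≤ T := by
  set F : ℝ → ℝ := fun x => ∫ t in (0:ℝ)..x, W t with hF
  have hFd : ∀ x, HasDerivAt F (W x) x := fun x => hW.integral_hasStrictDerivAt 0 x |>.hasDerivAt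
  set Z : ℝ → ℝ → ℝ := fun h x => h⁻¹ * (F (x - h) - F (x - 2 * h)) with hZ
  have hZd : ∀ h x, HasDerivAt (Z h) (h⁻¹ * (W (x - h) - W (x - 2 * h))) x := fun h x =>
    (((hFd _).comp_sub_const x h).sub ((hFd _).comp_sub_const x (2 * h))).const_mul h⁻¹
  have hZd' : ∀ h, deriv (Z h) = fun x => h⁻¹ * (W (x - h) - W (x - 2 * h)) := fun h =>
    funext fun x => (hZd h x).deriv
  have hZint : ∀ h x, Z h x = h⁻¹ * ∫ t in (x - 2 * h)..(x - h), W t := fun h x => by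
    simp only [hZ, hF]
    rw [intervalIntegral.integral_interval_sub_left (hW.intervalIntegrable _ _)
      (hW.intervalIntegrable _ _)]
  have hsmall : ∀ᶠ h in 𝓝[>] (0:ℝ), 0 < h ∧ b + 2 * h < 1 := by
    refine (eventually_mem_nhdsWithin).and (nhdsWithin_le_nhds ?_)
    have : Tendsto (fun h : ℝ => b + 2 * h) (𝓝 0) (𝓝 (b + 2 * 0)) :=
      (Continuous.tendsto (by fun_prop) 0)
    exact this.eventually_lt_const (by simpa using hb)
  have hadm : ∀ h, 0 < h → b + 2 * h < 1 → Z h ∈ admissibleFields ρ := by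
    intro h h0 h1
    have hsupp : tsupport (Z h) ⊆ Icc h (b + 2 * h) := by
      refine closure_minimal ?_ isClosed_Icc
      intro x hx
      by_contra hx'
      apply hx
      rw [hZint]
      have : ∫ t in (x - 2 * h)..(x - h), W t = ∫ t in (x - 2 * h)..(x - h), (0:ℝ) := by
        refine intervalIntegral.integral_congr fun t ht => ?_
        rw [uIcc_of_le (by linarith)] at ht
        rcases lt_or_ge x h with hxh | hxh
        · exact hW0 t (by linarith [ht.2])
        · refine hWb t ?_
          by_contra hlt
          exact hx' ⟨hxh, by linarith [ht.1]⟩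
      simp [this]
    refine ⟨?_, ?_, ?_, ?_⟩
    · rw [contDiff_one_iff_deriv]
      refine ⟨fun x => (hZd h x).differentiableAt, ?_⟩
      rw [hZd']
      fun_prop
    · exact HasCompactSupport.of_support_subset_isCompact isCompact_Icc
        ((subset_tsupport _).trans hsupp)
    · exact hsupp.trans (Icc_subset_Ioo h0 h1)
    · intro x hx
      rw [hZint, abs_mul, abs_of_pos (inv_pos.2 h0)]
      have : ‖∫ t in (x - 2 * h)..(x - h), W t‖ ≤ ρ x * |x - h - (x - 2 * h)| := by
        refine intervalIntegral.norm_integral_le_of_norm_le_const fun t ht => ?_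
        rw [uIoc_of_le (by linarith)] at ht
        rw [Real.norm_eq_abs]
        rcases le_or_gt t 0 with ht0 | ht0
        · rw [hW0 t ht0, abs_zero]
          exact (abs_nonneg _).trans (hWρ x hx)
        · have htx : t ≤ x := by linarith [ht.2]
          exact (hWρ t ⟨ht0, htx.trans_lt hx.2⟩).trans (hρ ⟨ht0, htx.trans_lt hx.2⟩ hx htx)
      rw [Real.norm_eq_abs, show x - h - (x - 2 * h) = h by ring, abs_of_pos h0] at this
      calc h⁻¹ * |∫ t in (x - 2 * h)..(x - h), W t| ≤ h⁻¹ * (ρ x * h) := by gcongr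
        _ = ρ x := by field_simp
  have hlim : Tendsto (fun h => ∫ x in Ioo (0:ℝ) 1, u x * deriv (Z h) x) (𝓝[>] (0:ℝ))
      (𝓝 (∫ x in Ioo (0:ℝ) 1, u x * g x)) := by
    refine tendsto_integral_filter_of_dominated_convergence (fun x => ‖u x * G x‖) ?_ ?_
      hGi.norm ?_
    · refine Eventually.of_forall fun h => ?_
      refine (hu.mul (Measurable.aemeasurable ?_)).aestronglyMeasurable
      exact measurable_deriv _
    · filter_upwards [hsmall] with h hh
      filter_upwards [ae_restrict_mem measurableSet_Ioo] with x hx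
      have h1 := hG x hx (x - 2 * h) (x - h) (by linarith) (by linarith)
      rw [hZd', norm_mul (u x), norm_mul (u x)]
      refine mul_le_mul_of_nonneg_left ?_ (norm_nonneg (u x))
      rw [Real.norm_eq_abs, abs_mul, abs_of_pos (inv_pos.2 hh.1)]
      calc h⁻¹ * |W (x - h) - W (x - 2 * h)| ≤ h⁻¹ * (G x * (x - h - (x - 2 * h))) := by
            have := inv_pos.2 hh.1
            gcongr
        _ = G x := by
            have := hh.1.ne'
            field_simp
            ring
        _ ≤ ‖G x‖ := le_abs_self _
    · filter_upwards [hg] with x hx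
      refine Tendsto.const_mul _ ?_
      have hs : ∀ c : ℝ, 0 < c → Tendsto (fun h => (c * h)⁻¹ * (W x - W (x - c * h))) (𝓝[>] (0:ℝ))
          (𝓝 (g x)) := by
        intro c hc
        have h1 := hx.tendsto_slope_zero_left
        have h2 : Tendsto (fun h : ℝ => -(c * h)) (𝓝[>] (0:ℝ)) (𝓝[<] 0) := by
          refine tendsto_nhdsWithin_iff.2 ⟨?_, ?_⟩
          · have : Tendsto (fun h : ℝ => -(c * h)) (𝓝 0) (𝓝 (-(c * 0))) :=
              Continuous.tendsto (by fun_prop) 0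
            simpa using this.mono_left nhdsWithin_le_nhds
          · filter_upwards [eventually_mem_nhdsWithin] with h hh
            have : 0 < c * h := mul_pos hc hh
            simpa using this
        refine (h1.comp h2).congr fun h => ?_
        simp only [Function.comp, smul_eq_mul, inv_neg, ← sub_eq_add_neg]
        ring
      have := ((hs 2 two_pos).const_mul 2).sub (hs 1 one_pos)
      rw [show 2 * g x - g x = g x by ring] at this
      refine this.congr fun h => ?_
      rw [hZd', one_mul, mul_inv]
      ring
  refine le_of_tendsto hlim ?_
  filter_upwards [hsmall] with h hh
  exact hT _ (hadm h hh.1 hh.2)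

lemma MemL2w.integrableOn_mul {φ a b : ℝ → ℝ} (hφm : Measurable φ)
    (hφ : ∀ x ∈ Ioo (0:ℝ) 1, 0 ≤ φ x) (ha : MemL2w φ a) (hb : MemL2w φ b) :
    IntegrableOn (fun x => a x * b x * φ x) (Ioo (0:ℝ) 1) := by
  refine Integrable.mono' (ha.2.add hb.2)
    ((ha.1.mul hb.1).mul hφm.aemeasurable).aestronglyMeasurable ?_
  filter_upwards [ae_restrict_mem measurableSet_Ioo] with x hx
  have h := hφ x hx
  rw [Real.norm_eq_abs, abs_mul, abs_of_nonneg h, Pi.add_apply, ← add_mul]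
  gcongr
  exact abs_le.2 ⟨by nlinarith [sq_nonneg (a x + b x)], by nlinarith [sq_nonneg (a x - b x)]⟩

lemma MemL2w.add {φ a b : ℝ → ℝ} (hφm : Measurable φ)
    (hφ : ∀ x ∈ Ioo (0:ℝ) 1, 0 ≤ φ x) (ha : MemL2w φ a) (hb : MemL2w φ b) :
    MemL2w φ (fun x => a x + b x) := by
  refine ⟨ha.1.add hb.1, ?_⟩
  refine ((ha.2.add hb.2).add ((ha.integrableOn_mul hφm hφ hb).const_mul 2)).congr
    (Eventually.of_forall fun x => ?_)
  simp only [Pi.add_apply]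
  ring

lemma MemL2w.neg {φ a : ℝ → ℝ} (ha : MemL2w φ a) : MemL2w φ (fun x => -a x) :=
  ⟨ha.1.neg, by simpa using ha.2⟩

lemma MemL2w.indicator {φ a : ℝ → ℝ} (ha : MemL2w φ a) {s : Set ℝ} (hs : MeasurableSet s) :
    MemL2w φ (s.indicator a) := by
  refine ⟨ha.1.indicator hs, (ha.2.indicator hs).congr (Eventually.of_forall fun x => ?_)⟩
  by_cases hx : x ∈ s <;> simp [hx]

lemma memL2w_rpow {φ : ℝ → ℝ} {D γ : ℝ} (hφ : ∀ r, φ r = r ^ (D - 1)) (h : 2 * γ < D) :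
    MemL2w φ (fun r => r ^ (-γ)) := by
  refine ⟨Measurable.aemeasurable (by fun_prop), ?_⟩
  have : IntegrableOn (fun x : ℝ => x ^ (D - 1 - 2 * γ)) (Ioo 0 1) :=
    (intervalIntegral.integrableOn_Ioo_rpow_iff one_pos).2 (by linarith)
  refine this.congr_fun (fun x hx => ?_) measurableSet_Ioo
  simp only [hφ]
  rw [← Real.rpow_natCast, ← Real.rpow_mul hx.1.le, ← Real.rpow_add hx.1]
  congr 1
  push_cast
  ring

lemma memL2w_const {φ : ℝ → ℝ} {D : ℝ} (hφ : ∀ r, φ r = r ^ (D - 1)) (hD : 0 < D) (c : ℝ) :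
    MemL2w φ (fun _ => c) := by
  have := (memL2w_rpow (γ := 0) hφ (by linarith)).2
  refine ⟨aemeasurable_const, (this.const_mul (c ^ 2)).congr (Eventually.of_forall fun x => ?_)⟩
  simp

lemma integrableOn_mul_deriv {φ u z : ℝ → ℝ} (hφm : Measurable φ)
    (hφc : ContinuousOn φ (Ioo (0:ℝ) 1)) (hφ : ∀ x ∈ Ioo (0:ℝ) 1, 0 < φ x)
    (h1 : MemL2w φ (fun _ => 1)) (hu : MemL2w φ u) (hz : z ∈ admissibleFields φ) :
    IntegrableOn (fun x => u x * deriv z x) (Ioo (0:ℝ) 1) := by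
  have hzc : Continuous (deriv z) := hz.1.continuous_deriv le_rfl
  have hK : IsCompact (tsupport z) := hz.2.1
  obtain ⟨C, hC⟩ := hK.exists_bound_of_continuousOn (f := fun x => deriv z x / φ x)
    (hzc.continuousOn.div (hφc.mono hz.2.2.1) fun x hx => (hφ x (hz.2.2.1 hx)).ne')
  refine Integrable.mono' ((hu.integrableOn_mul hφm (fun x hx => (hφ x hx).le) h1).norm.const_mul |C|)
    (hu.1.mul hzc.measurable.aemeasurable).aestronglyMeasurable ?_
  filter_upwards [ae_restrict_mem measurableSet_Ioo] with x hx
  have hp := hφ x hx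
  have hb : |deriv z x| ≤ |C| * φ x := by
    by_cases hxK : x ∈ tsupport z
    · have := hC x hxK
      rw [Real.norm_eq_abs, abs_div, abs_of_pos hp, div_le_iff₀ hp] at this
      exact this.trans (by gcongr; exact le_abs_self C)
    · have : deriv z x = 0 := by
        by_contra hne
        exact hxK (support_deriv_subset hne)
      rw [this, abs_zero]
      positivity
  rw [norm_mul, norm_mul, norm_mul, norm_one, mul_one, Real.norm_eq_abs, Real.norm_eq_abs,
    Real.norm_eq_abs, abs_of_pos hp]
  calc |u x| * |deriv z x| ≤ |u x| * (|C| * φ x) := by gcongr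
    _ = _ := by ring

/-- Consequence of minimality for perturbations of `u` on `(0,s)`. -/
lemma variation_inequality {φ f u : ℝ → ℝ} {α D : ℝ} (hα : 0 < α) (hD : 1 ≤ D)
    (hφ : ∀ r, φ r = r ^ (D - 1)) (hf : MemL2w φ f) (hu : IsEROFMinimizer φ φ f α u) :
    ∃ T : ℝ, (∀ z ∈ admissibleFields φ, ∫ x in Ioo (0:ℝ) 1, u x * deriv z x ≤ T) ∧
      ∀ s ∈ Ioo (0:ℝ) 1, ∀ w T', MemL2w φ w →
        (∀ z ∈ admissibleFields φ, (∫ x in Ioo (0:ℝ) 1, u x * deriv z x) +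
          (∫ x in Ioo (0:ℝ) s, w x * deriv z x) ≤ T') →
        α * T ≤ (∫ x in Ioo (0:ℝ) s, (2 * (u x - f x) * w x + w x ^ 2) * φ x) + α * T' := by
  have hφm : Measurable φ := by
    rw [funext hφ]
    fun_prop
  have hφp : ∀ x ∈ Ioo (0:ℝ) 1, 0 < φ x := fun x hx => by
    rw [hφ]
    exact Real.rpow_pos_of_pos hx.1 _
  have hφ0 : ∀ x ∈ Ioo (0:ℝ) 1, 0 ≤ φ x := fun x hx => (hφp x hx).le
  have hφc : ContinuousOn φ (Ioo (0:ℝ) 1) := by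
    rw [funext hφ]
    exact (Real.continuous_rpow_const (by linarith)).continuousOn
  obtain ⟨T, hT, hmin⟩ := hu.exists_real hα hφ0
  refine ⟨T, hT, fun s hs w T' hw hw' => ?_⟩
  have hsub : Ioo (0:ℝ) s ⊆ Ioo (0:ℝ) 1 := Ioo_subset_Ioo_right hs.2.le
  have hwi : MemL2w φ ((Ioo (0:ℝ) s).indicator w) := hw.indicator measurableSet_Ioo
  have huf : MemL2w φ (fun x => u x - f x) := by
    simpa [sub_eq_add_neg] using hu.1.add hφm hφ0 hf.neg
  have hset : ∀ h : ℝ → ℝ, ∫ x in Ioo (0:ℝ) 1, (Ioo (0:ℝ) s).indicator h x =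
      ∫ x in Ioo (0:ℝ) s, h x := fun h => by
    rw [setIntegral_indicator measurableSet_Ioo, inter_eq_right.2 hsub]
  have h := hmin _ T' (hu.1.add hφm hφ0 hwi) fun z hz => by
    have hz1 := integrableOn_mul_deriv hφm hφc hφp (memL2w_const hφ (by linarith) 1) hu.1 hz
    have hz2 := integrableOn_mul_deriv hφm hφc hφp (memL2w_const hφ (by linarith) 1) hwi hz
    simp only [add_mul]
    rw [integral_add hz1 hz2]
    convert hw' z hz using 2
    rw [← hset]
    refine integral_congr_ae (Eventually.of_forall fun x => ?_)
    by_cases hx : x ∈ Ioo (0:ℝ) s <;> simp [hx]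
  have hi : IntegrableOn (fun x => (2 * (u x - f x) * w x + w x ^ 2) * φ x) (Ioo (0:ℝ) 1) := by
    refine (((huf.integrableOn_mul hφm hφ0 hw).const_mul 2).add hw.2).congr
      (Eventually.of_forall fun x => ?_)
    simp only [Pi.add_apply]
    ring
  have he : (∫ x in Ioo (0:ℝ) 1, (u x + (Ioo (0:ℝ) s).indicator w x - f x) ^ 2 * φ x) =
      (∫ x in Ioo (0:ℝ) 1, (u x - f x) ^ 2 * φ x) +
        ∫ x in Ioo (0:ℝ) s, (2 * (u x - f x) * w x + w x ^ 2) * φ x := by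
    rw [← hset, ← integral_add huf.2 (hi.indicator measurableSet_Ioo)]
    refine integral_congr_ae (Eventually.of_forall fun x => ?_)
    by_cases hx : x ∈ Ioo (0:ℝ) s
    · simp only [hx, indicator_of_mem]
      ring
    · simp only [hx, indicator_of_notMem, not_false_eq_true]
      ring
  rw [he] at h
  linarith

lemma admissible_integral_deriv {φ z : ℝ → ℝ} (hz : z ∈ admissibleFields φ) {s : ℝ} (hs : 0 ≤ s) :
    ∫ x in Ioo (0:ℝ) s, deriv z x = z s := by
  have hz0 : z 0 = 0 := image_eq_zero_of_notMem_tsupport fun h => lt_irrefl _ (hz.2.2.1 h).1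
  rw [← integral_Ioc_eq_integral_Ioo, ← intervalIntegral.integral_of_le hs,
    intervalIntegral.integral_deriv_eq_sub (fun x _ => hz.1.differentiable one_ne_zero x)
      ((hz.1.continuous_deriv le_rfl).intervalIntegrable _ _), hz0, sub_zero]

lemma setIntegral_rpow {p s : ℝ} (hp : 0 < p) (hs : 0 ≤ s) :
    ∫ x in Ioo (0:ℝ) s, x ^ (p - 1) = s ^ p / p := by
  rw [← integral_Ioc_eq_integral_Ioo, ← intervalIntegral.integral_of_le hs,
    integral_rpow (Or.inl (by linarith))]
  simp [Real.zero_rpow hp.ne']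

lemma abs_rpow_sub_self_le {x p : ℝ} (hx : 0 < x) (hx1 : x ≤ 1) (hp : 0 < p) :
    |x ^ p - x| ≤ max 1 p * (1 - x) := by
  have h1 : x ^ p ≤ 1 := Real.rpow_le_one hx.le hx1 hp.le
  have hm1 : (1 - x) ≤ max 1 p * (1 - x) :=
    le_mul_of_one_le_left (by linarith) (le_max_left _ _)
  refine abs_le.2 ⟨?_, by linarith⟩
  rcases le_total p 1 with h | h
  · have := Real.rpow_le_rpow_of_exponent_ge hx hx1 h
    rw [Real.rpow_one] at this
    linarith
  · have := one_add_mul_self_le_rpow_one_add (s := x - 1) (by linarith) h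
    rw [show 1 + (x - 1) = x by ring] at this
    rw [max_eq_right h]
    nlinarith

/-- The field obtained by transporting the boundary value `ζ` into `(0,s)` and correcting it by the
data stays below the weight. -/
lemma abs_inner_field_le {D β B ζ s r : ℝ} (hD : 0 < D) (hβD : β < D) (hβ : β < 1) (hB : 0 ≤ B)
    (hs : 0 < s) (hζ : |ζ| ≤ s ^ (D - 1)) (hBs : B * s ^ (1 - β) * max 1 (1 - β) ≤ 1)
    (hr : 0 ≤ r) (hrs : r ≤ s) :
    |(ζ / s ^ D - B * s ^ (-β)) * r ^ D + B * r ^ (D - β)| ≤ r ^ (D - 1) := by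
  rcases hr.eq_or_lt with rfl | hr
  · rw [Real.zero_rpow hD.ne', Real.zero_rpow (by linarith)]
    simpa using Real.rpow_nonneg le_rfl _
  set x := r / s with hx
  have hx0 : 0 < x := div_pos hr hs
  have hx1 : x ≤ 1 := (div_le_one hs).2 hrs
  have hrx : r = x * s := by rw [hx]; field_simp
  have hsp := Real.rpow_pos_of_pos hs (D - 1)
  have e1 : s ^ D = s ^ (D - 1) * s := by
    rw [← Real.rpow_add_one hs.ne']; congr 1; ring
  have e2 : r ^ D = r ^ (D - 1) * r := by
    rw [← Real.rpow_add_one hr.ne']; congr 1; ring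
  have e3 : r ^ (D - β) = r ^ (D - 1) * (x ^ (1 - β) * s ^ (1 - β)) := by
    rw [← Real.mul_rpow hx0.le hs.le, ← hrx, ← Real.rpow_add hr]; congr 1; ring
  have e4 : s ^ (1 - β) = s ^ (-β) * s := by
    rw [← Real.rpow_add_one hs.ne']; congr 1; ring
  have key : (ζ / s ^ D - B * s ^ (-β)) * r ^ D + B * r ^ (D - β) =
      r ^ (D - 1) * (ζ / s ^ (D - 1) * x + B * s ^ (1 - β) * (x ^ (1 - β) - x)) := by
    rw [e1, e2, e3, e4, hx]
    field_simp
    ring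
  rw [key, abs_mul, abs_of_pos (Real.rpow_pos_of_pos hr _)]
  refine mul_le_of_le_one_right (Real.rpow_nonneg hr.le _) ?_
  have hq : |ζ / s ^ (D - 1)| ≤ 1 := by
    rw [abs_div, abs_of_pos hsp]
    exact (div_le_one hsp).2 hζ
  have hBs0 : 0 ≤ B * s ^ (1 - β) := mul_nonneg hB (Real.rpow_nonneg hs.le _)
  calc |ζ / s ^ (D - 1) * x + B * s ^ (1 - β) * (x ^ (1 - β) - x)|
      ≤ |ζ / s ^ (D - 1) * x| + |B * s ^ (1 - β) * (x ^ (1 - β) - x)| := abs_add_le _ _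
    _ = |ζ / s ^ (D - 1)| * x + B * s ^ (1 - β) * |x ^ (1 - β) - x| := by
        rw [abs_mul, abs_mul, abs_of_pos hx0, abs_of_nonneg hBs0]
    _ ≤ 1 * x + B * s ^ (1 - β) * (max 1 (1 - β) * (1 - x)) := by
        gcongr
        exact abs_rpow_sub_self_le hx0 hx1 (by linarith)
    _ = x + (B * s ^ (1 - β) * max 1 (1 - β)) * (1 - x) := by ring
    _ ≤ x + 1 * (1 - x) := by
        have : 0 ≤ 1 - x := by linarith
        gcongr
    _ = 1 := by ring

/-- The field which equals `z` on `(s,1)` and an explicit primitive on `(0,s)` bounds the total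
variation from below. -/
lemma integral_glued_field_le {φ u z : ℝ → ℝ} {D β B s T : ℝ} (hD : 2 ≤ D) (hβD : 2 * β < D)
    (hβ : β < 1) (hB : 0 ≤ B) (hφ : ∀ r, φ r = r ^ (D - 1)) (hu : MemL2w φ u)
    (hT : ∀ z ∈ admissibleFields φ, ∫ x in Ioo (0:ℝ) 1, u x * deriv z x ≤ T)
    (hz : z ∈ admissibleFields φ) (hs : s ∈ Ioo (0:ℝ) 1)
    (hBs : B * s ^ (1 - β) * max 1 (1 - β) ≤ 1) :
    (∫ x in Ioo (0:ℝ) 1, u x * deriv z x) - (∫ x in Ioo (0:ℝ) s, u x * deriv z x) +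
      ((z s / s ^ D - B * s ^ (-β)) * D * (∫ x in Ioo (0:ℝ) s, u x * φ x) +
        B * (D - β) * ∫ x in Ioo (0:ℝ) s, u x * x ^ (-β) * φ x) ≤ T := by
  have hφm : Measurable φ := by
    rw [funext hφ]
    fun_prop
  have hφp : ∀ x ∈ Ioo (0:ℝ) 1, 0 < φ x := fun x hx => by
    rw [hφ]
    exact Real.rpow_pos_of_pos hx.1 _
  have hφ0 : ∀ x ∈ Ioo (0:ℝ) 1, 0 ≤ φ x := fun x hx => (hφp x hx).le
  have hφc : ContinuousOn φ (Ioo (0:ℝ) 1) := by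
    rw [funext hφ]
    exact (Real.continuous_rpow_const (by linarith)).continuousOn
  have hsub : Ioo (0:ℝ) s ⊆ Ioo (0:ℝ) 1 := Ioo_subset_Ioo_right hs.2.le
  set A := z s / s ^ D - B * s ^ (-β) with hA
  set P : ℝ → ℝ := fun r => A * r ^ D + B * r ^ (D - β) with hP
  set P' : ℝ → ℝ := fun r => A * (D * r ^ (D - 1)) + B * ((D - β) * r ^ (D - β - 1)) with hP'
  have hPd : ∀ r, HasDerivAt P (P' r) r := fun r =>
    ((Real.hasDerivAt_rpow_const (Or.inr (by linarith))).const_mul A).add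
      ((Real.hasDerivAt_rpow_const (Or.inr (by linarith))).const_mul B)
  have hPc : Continuous P := continuous_iff_continuousAt.2 fun r => (hPd r).continuousAt
  have hP0 : P 0 = 0 := by
    simp only [hP]
    rw [Real.zero_rpow (by linarith), Real.zero_rpow (by linarith)]
    simp
  have hzc : Continuous (deriv z) := hz.1.continuous_deriv le_rfl
  obtain ⟨L, hL⟩ := hz.2.1.deriv.exists_bound_of_continuous hzc
  have hL0 : 0 ≤ L := (norm_nonneg _).trans (hL 0)
  have hzL : ∀ x y, |z y - z x| ≤ L * |y - x| := fun x y =>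
    Convex.norm_image_sub_le_of_norm_deriv_le (fun t _ => hz.1.differentiable one_ne_zero t)
      (fun t _ => hL t) convex_univ (mem_univ x) (mem_univ y)
  set Q : ℝ → ℝ := fun r => |A| * (D * r ^ (D - 1)) + B * ((D - β) * r ^ (D - β - 1)) with hQ
  have hQ0 : ∀ r, 0 ≤ r → 0 ≤ Q r := fun r hr => by
    have h1 := Real.rpow_nonneg hr (D - 1)
    have h2 := Real.rpow_nonneg hr (D - β - 1)
    have h3 : 0 ≤ D - β := by linarith
    positivity
  have hPQ : ∀ w, ∀ x ∈ Icc 0 w, ∀ y ∈ Icc 0 w, |P y - P x| ≤ Q w * |y - x| := by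
    intro w x hx y hy
    refine Convex.norm_image_sub_le_of_norm_hasDerivWithin_le
      (fun t _ => (hPd t).hasDerivWithinAt) (fun t ht => ?_) (convex_Icc 0 w) hx hy
    have h1 := Real.rpow_nonneg ht.1 (D - 1)
    have h2 := Real.rpow_nonneg ht.1 (D - β - 1)
    have h3 : 0 ≤ D - β := by linarith
    have h4 := Real.rpow_le_rpow ht.1 ht.2 (show 0 ≤ D - 1 by linarith)
    have h5 := Real.rpow_le_rpow ht.1 ht.2 (show 0 ≤ D - β - 1 by linarith)
    refine (abs_add_le _ _).trans ?_
    rw [abs_mul, abs_of_nonneg (show 0 ≤ D * t ^ (D - 1) by positivity),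
      abs_of_nonneg (show 0 ≤ B * ((D - β) * t ^ (D - β - 1)) by positivity)]
    simp only [hQ]
    gcongr
  have hzs := hz.2.2.2 s hs
  rw [hφ] at hzs
  set W : ℝ → ℝ := fun x => P (max 0 (min x s)) + (z (max x s) - z s) with hW
  obtain ⟨b, hb1, hb⟩ : ∃ b < 1, ∀ x, b ≤ x → z x = 0 := by
    rcases (tsupport z).eq_empty_or_nonempty with he | hne
    · exact ⟨0, one_pos, fun x _ => image_eq_zero_of_notMem_tsupport (by simp [he])⟩
    · obtain ⟨m, hm, hmax⟩ := hz.2.1.isCompact.exists_isGreatest hne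
      refine ⟨(m + 1) / 2, by linarith [(hz.2.2.1 hm).2], fun x hx => ?_⟩
      refine image_eq_zero_of_notMem_tsupport fun h => ?_
      linarith [hmax h, (hz.2.2.1 hm).2]
  have hPs : P s = z s := by
    have h1 := Real.rpow_pos_of_pos hs.1 D
    have h2 : s ^ (D - β) = s ^ (-β) * s ^ D := by
      rw [← Real.rpow_add hs.1]
      congr 1
      ring
    simp only [hP, hA, h2]
    field_simp
    ring
  have hWlo : ∀ x, 0 ≤ x → x ≤ s → W x = P x := fun x h0 h1 => by
    simp [hW, h0, h1]
  have hWhi : ∀ x, s ≤ x → W x = z x := fun x h1 => by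
    simp [hW, h1, hs.1.le, hPs]
  have hQi : IntegrableOn (fun x => u x * (Q x + (Ioi s).indicator (fun _ => L) x))
      (Ioo (0:ℝ) 1) := by
    have i1 := hu.integrableOn_mul hφm hφ0 (memL2w_const hφ (by linarith) (|A| * D))
    have i2 := (hu.integrableOn_mul hφm hφ0 (memL2w_rpow hφ hβD)).const_mul (B * (D - β))
    have i3 : IntegrableOn (fun x => u x * (Ioi s).indicator (fun _ => L) x) (Ioo (0:ℝ) 1) := by
      refine Integrable.mono' ((hu.integrableOn_mul hφm hφ0
        (memL2w_const hφ (by linarith) 1)).norm.const_mul (L / s ^ (D - 1)))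
        (hu.1.mul (Measurable.aemeasurable
          (measurable_const.indicator measurableSet_Ioi))).aestronglyMeasurable ?_
      filter_upwards [ae_restrict_mem measurableSet_Ioo] with x hx
      have hsp := Real.rpow_pos_of_pos hs.1 (D - 1)
      by_cases hxs : x ∈ Ioi s
      · have h1 : s ^ (D - 1) ≤ φ x := by
          rw [hφ]
          exact Real.rpow_le_rpow hs.1.le (le_of_lt hxs) (by linarith)
        rw [indicator_of_mem hxs, norm_mul, norm_mul, norm_mul, norm_one, mul_one,
          Real.norm_of_nonneg hL0, Real.norm_of_nonneg (hφ0 x hx), div_mul_eq_mul_div,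
          le_div_iff₀ hsp]
        calc ‖u x‖ * L * s ^ (D - 1) ≤ ‖u x‖ * L * φ x := by gcongr
          _ = _ := by ring
      · rw [indicator_of_notMem hxs, mul_zero, norm_zero]
        positivity
    refine ((i1.add i2).add i3).congr_fun (fun x hx => ?_) measurableSet_Ioo
    simp only [Pi.add_apply, hQ, hφ]
    rw [show D - β - 1 = -β + (D - 1) by ring, Real.rpow_add hx.1]
    ring
  have hfield := integral_mul_le_of_continuous_field (ρ := φ) (u := u) (W := W) (T := T)
    (b := max b s) (g := fun x => deriv z x + (Ioo (0:ℝ) s).indicator (fun x => P' x - deriv z x) x)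
    (G := fun x => Q x + (Ioi s).indicator (fun _ => L) x) hT
    (fun x hx y hy hxy => by
      rw [hφ, hφ]
      exact Real.rpow_le_rpow hx.1.le hxy (by linarith)) hu.1
    (by have := hz.1.continuous; fun_prop) (max_lt hb1 hs.2)
    (fun x hx => by
      have h1 : min x s = x := min_eq_left (hx.trans hs.1.le)
      have h2 : max x s = s := max_eq_right (hx.trans hs.1.le)
      simp [hW, h1, h2, hx, hP0])
    (fun x hx => by
      rw [hWhi x ((le_max_right _ _).trans hx), hb x ((le_max_left _ _).trans hx)])
    (fun x hx => by
      rcases le_total x s with h | h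
      · rw [hWlo x hx.1.le h, hφ]
        exact abs_inner_field_le (by linarith) (by linarith) hβ hB hs.1 hzs hBs hx.1.le h
      · rw [hWhi x h]
        exact hz.2.2.2 x hx)
    (fun w hw x y hxy hyw => by
      have hc1 : max 0 (min x s) ≤ max 0 (min y s) := by gcongr
      have hc2 : max 0 (min y s) ≤ w := max_le hw.1.le ((min_le_left _ _).trans hyw)
      have hc3 : max 0 (min y s) - max 0 (min x s) ≤ y - x := by
        have := hs.1
        simp only [max_def, min_def]
        split_ifs <;> linarith
      have h1 := hPQ w (max 0 (min x s)) ⟨le_max_left _ _, hc1.trans hc2⟩ (max 0 (min y s))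
        ⟨le_max_left _ _, hc2⟩
      rw [abs_of_nonneg (sub_nonneg.2 hc1)] at h1
      have h1' := h1.trans (mul_le_mul_of_nonneg_left hc3 (hQ0 w hw.1.le))
      have h2 : |z (max y s) - z (max x s)| ≤ (Ioi s).indicator (fun _ => L) w * (y - x) := by
        rcases le_or_gt y s with h | h
        · rw [max_eq_right h, max_eq_right (hxy.trans h), sub_self, abs_zero]
          exact mul_nonneg (indicator_nonneg (fun _ _ => hL0) _) (sub_nonneg.2 hxy)
        · rw [indicator_of_mem (show w ∈ Ioi s from h.trans_le hyw)]
          refine (hzL _ _).trans (mul_le_mul_of_nonneg_left ?_ hL0)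
          rw [abs_of_nonneg (sub_nonneg.2 (max_le_max_right s hxy)), max_eq_left h.le]
          linarith [le_max_left x s]
      calc |W y - W x| = |(P (max 0 (min y s)) - P (max 0 (min x s))) +
            (z (max y s) - z (max x s))| := by
            simp only [hW]
            congr 1
            ring
        _ ≤ _ := (abs_add_le _ _).trans (add_le_add h1' h2)
        _ = _ := by ring)
    hQi
    (by
      filter_upwards [ae_restrict_mem measurableSet_Ioo,
        ae_restrict_of_ae (Measure.ae_ne volume s)] with x hx hxs
      rcases lt_or_gt_of_ne hxs with h | h
      · rw [indicator_of_mem (show x ∈ Ioo (0:ℝ) s from ⟨hx.1, h⟩), add_sub_cancel]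
        refine (hPd x).congr_of_eventuallyEq ?_
        filter_upwards [Ioo_mem_nhds hx.1 h] with y hy using hWlo y hy.1.le hy.2.le
      · rw [indicator_of_notMem (fun h' => lt_asymm h h'.2), add_zero]
        refine (hz.1.differentiable one_ne_zero x).hasDerivAt.congr_of_eventuallyEq ?_
        filter_upwards [Ioi_mem_nhds h] with y hy using hWhi y (le_of_lt hy))
  refine le_trans (le_of_eq ?_) hfield
  have i0 := integrableOn_mul_deriv hφm hφc hφp (memL2w_const hφ (by linarith) 1) hu hz
  have i1 : IntegrableOn (fun x => u x * φ x) (Ioo (0:ℝ) 1) := by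
    simpa using hu.integrableOn_mul hφm hφ0 (memL2w_const hφ (by linarith) 1)
  have i2 := hu.integrableOn_mul hφm hφ0 (memL2w_rpow hφ hβD)
  have i3 : IntegrableOn (fun x => u x * P' x) (Ioo (0:ℝ) 1) ∧
      ∫ x in Ioo (0:ℝ) s, u x * P' x = A * D * (∫ x in Ioo (0:ℝ) s, u x * φ x) +
        B * (D - β) * ∫ x in Ioo (0:ℝ) s, u x * x ^ (-β) * φ x := by
    have e : ∀ x ∈ Ioo (0:ℝ) 1, A * D * (u x * φ x) + B * (D - β) * (u x * x ^ (-β) * φ x) =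
        u x * P' x := fun x hx => by
      simp only [hP', hφ]
      rw [show D - β - 1 = -β + (D - 1) by ring, Real.rpow_add hx.1]
      ring
    refine ⟨IntegrableOn.congr_fun ((i1.const_mul (A * D)).add (i2.const_mul (B * (D - β)))) e
      measurableSet_Ioo, ?_⟩
    rw [← setIntegral_congr_fun measurableSet_Ioo fun x hx => e x (hsub hx),
      integral_add ((i1.mono_set hsub).const_mul _) ((i2.mono_set hsub).const_mul _),
      integral_const_mul, integral_const_mul]
  have i4 : IntegrableOn (fun x => u x * (P' x - deriv z x)) (Ioo (0:ℝ) 1) := by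
    simp only [mul_sub]
    exact i3.1.sub i0
  have e5 : ∀ x, u x * (deriv z x + (Ioo (0:ℝ) s).indicator (fun x => P' x - deriv z x) x) =
      u x * deriv z x + (Ioo (0:ℝ) s).indicator (fun x => u x * (P' x - deriv z x)) x := fun x => by
    by_cases hx : x ∈ Ioo (0:ℝ) s
    · simp only [hx, indicator_of_mem]
      ring
    · simp [hx]
  simp only [e5]
  rw [integral_add i0 (i4.indicator measurableSet_Ioo), setIntegral_indicator measurableSet_Ioo,
    inter_eq_right.2 hsub]
  simp only [mul_sub]
  rw [integral_sub (i3.1.mono_set hsub) (i0.mono_set hsub), i3.2]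
  ring

/-- If `β < 1`, the minimizer is constant near `0`. -/
lemma exists_ae_eq_const {φ f u : ℝ → ℝ} {α β D δ₀ : ℝ} (hα : 0 < α) (hD : 2 ≤ D)
    (hβD : 2 * β < D) (hβ : β < 1) (hδ₀ : δ₀ ∈ Ioo (0:ℝ) 1) (hφ : ∀ r, φ r = r ^ (D - 1))
    (hfpow : ∀ r ∈ Ioo (0:ℝ) δ₀, f r = r ^ (-β)) (hf : MemL2w φ f)
    (hu : IsEROFMinimizer φ φ f α u) :
    ∃ s ∈ Ioo (0:ℝ) 1, ∃ c : ℝ, ∀ᵐ x ∂(volume.restrict (Ioo (0:ℝ) s)), u x = c := by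
  have hφm : Measurable φ := by
    rw [funext hφ]
    fun_prop
  have hφp : ∀ x ∈ Ioo (0:ℝ) 1, 0 < φ x := fun x hx => by
    rw [hφ]
    exact Real.rpow_pos_of_pos hx.1 _
  have hφ0 : ∀ x ∈ Ioo (0:ℝ) 1, 0 ≤ φ x := fun x hx => (hφp x hx).le
  have hDβ : 0 < D - β := by linarith
  obtain ⟨T, hT, hvar⟩ := variation_inequality hα (by linarith) hφ hf hu
  set B : ℝ := 2 / α / (D - β) with hB
  have hB0 : 0 ≤ B := by positivity
  obtain ⟨s, hBs, hs0, hsδ⟩ : ∃ s, B * s ^ (1 - β) * max 1 (1 - β) ≤ 1 ∧ 0 < s ∧ s < δ₀ := by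
    have h1 : Tendsto (fun s : ℝ => B * s ^ (1 - β) * max 1 (1 - β)) (𝓝[>] 0) (𝓝 0) := by
      have : Continuous fun s : ℝ => B * s ^ (1 - β) * max 1 (1 - β) :=
        ((Real.continuous_rpow_const (by linarith)).const_mul B).mul_const _
      have h := (this.tendsto 0).mono_left (nhdsWithin_le_nhds (s := Ioi 0))
      rwa [Real.zero_rpow (by linarith), mul_zero, zero_mul] at h
    have h2 := (h1.eventually_le_const one_pos).and (Ioo_mem_nhdsGT hδ₀.1)
    obtain ⟨s, h, h'⟩ := h2.exists
    exact ⟨s, h, h'.1, h'.2⟩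
  have hs : s ∈ Ioo (0:ℝ) 1 := ⟨hs0, hsδ.trans hδ₀.2⟩
  have hsub : Ioo (0:ℝ) s ⊆ Ioo (0:ℝ) 1 := Ioo_subset_Ioo_right hs.2.le
  have hone : MemL2w φ (fun _ => 1) := memL2w_const hφ (by linarith) 1
  have iu : IntegrableOn (fun x => u x * φ x) (Ioo (0:ℝ) s) := by
    simpa using (hu.1.integrableOn_mul hφm hφ0 hone).mono_set hsub
  have ifφ : IntegrableOn (fun x => f x * φ x) (Ioo (0:ℝ) s) := by
    simpa using (hf.integrableOn_mul hφm hφ0 hone).mono_set hsub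
  have iφ : IntegrableOn φ (Ioo (0:ℝ) s) := by
    simpa using (hone.integrableOn_mul hφm hφ0 hone).mono_set hsub
  have iuf := (hu.1.integrableOn_mul hφm hφ0 hf).mono_set hsub
  set I := ∫ x in Ioo (0:ℝ) s, u x * φ x with hI
  set J := ∫ x in Ioo (0:ℝ) s, u x * f x * φ x with hJ
  set c := D * I / s ^ D with hc
  set m := D * s ^ (-β) / (D - β) with hm
  have hsD : 0 < s ^ D := Real.rpow_pos_of_pos hs0 D
  have hw : MemL2w φ (fun x => c + -u x) :=
    (memL2w_const hφ (by linarith) c).add hφm hφ0 hu.1.neg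
  have hφint : ∫ x in Ioo (0:ℝ) s, φ x = s ^ D / D := by
    rw [funext hφ, setIntegral_rpow (by linarith) hs0.le]
  have hfint : ∫ x in Ioo (0:ℝ) s, f x * φ x = m * s ^ D / D := by
    have : ∫ x in Ioo (0:ℝ) s, f x * φ x = ∫ x in Ioo (0:ℝ) s, x ^ (D - β - 1) := by
      refine setIntegral_congr_fun measurableSet_Ioo fun x hx => ?_
      simp only [hφ]
      rw [hfpow x ⟨hx.1, hx.2.trans hsδ⟩, ← Real.rpow_add hx.1]
      congr 1
      ring
    rw [this, setIntegral_rpow hDβ hs0.le, hm, sub_eq_neg_add D β, Real.rpow_add hs0]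
    field_simp
  have hJ' : ∫ x in Ioo (0:ℝ) s, u x * x ^ (-β) * φ x = J := by
    refine setIntegral_congr_fun measurableSet_Ioo fun x hx => ?_
    simp only [hfpow x ⟨hx.1, hx.2.trans hsδ⟩]
  have hmain := hvar s hs (fun x => c + -u x) (T - 2 / α * (J - m * I)) hw fun z hz => by
    have h := integral_glued_field_le hD hβD hβ hB0 hφ hu.1 hT hz hs hBs
    rw [hJ', ← hI] at h
    have hzi := (integrableOn_mul_deriv hφm (by
      rw [funext hφ]
      exact (Real.continuous_rpow_const (by linarith)).continuousOn) hφp hone hu.1 hz).mono_set hsub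
    have hz1 := (integrableOn_mul_deriv (u := fun _ => c) hφm (by
      rw [funext hφ]
      exact (Real.continuous_rpow_const (by linarith)).continuousOn) hφp hone
      (memL2w_const hφ (by linarith) c) hz).mono_set hsub
    have e : ∫ x in Ioo (0:ℝ) s, (c + -u x) * deriv z x =
        c * z s - ∫ x in Ioo (0:ℝ) s, u x * deriv z x := by
      simp only [add_mul, neg_mul]
      simp only [← sub_eq_add_neg]
      rw [integral_sub hz1 hzi, integral_const_mul, admissible_integral_deriv hz hs0.le]
    have e2 : (z s / s ^ D - B * s ^ (-β)) * D * I + B * (D - β) * J =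
        c * z s + 2 / α * (J - m * I) := by
      rw [hc, hm, hB]
      field_simp
      ring
    rw [e]
    linarith
  have icu : IntegrableOn (fun x => (c + -u x) ^ 2 * φ x) (Ioo (0:ℝ) s) := hw.2.mono_set hsub
  have e3 : ∫ x in Ioo (0:ℝ) s, (2 * (u x - f x) * (c + -u x) + (c + -u x) ^ 2) * φ x =
      2 * (J - m * I) - ∫ x in Ioo (0:ℝ) s, (c + -u x) ^ 2 * φ x := by
    have e4 : ∀ x, (2 * (u x - f x) * (c + -u x) + (c + -u x) ^ 2) * φ x =
        2 * c ^ 2 * φ x - 2 * c * (u x * φ x) - 2 * c * (f x * φ x) + 2 * (u x * f x * φ x) -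
          (c + -u x) ^ 2 * φ x := fun x => by ring
    simp only [e4]
    have j1 := iφ.const_mul (2 * c ^ 2)
    have j2 : IntegrableOn (fun x => 2 * c ^ 2 * φ x - 2 * c * (u x * φ x)) (Ioo (0:ℝ) s) :=
      j1.sub (iu.const_mul (2 * c))
    have j3 : IntegrableOn (fun x => 2 * c ^ 2 * φ x - 2 * c * (u x * φ x) -
        2 * c * (f x * φ x)) (Ioo (0:ℝ) s) := j2.sub (ifφ.const_mul (2 * c))
    have j4 : IntegrableOn (fun x => 2 * c ^ 2 * φ x - 2 * c * (u x * φ x) -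
        2 * c * (f x * φ x) + 2 * (u x * f x * φ x)) (Ioo (0:ℝ) s) := j3.add (iuf.const_mul 2)
    rw [integral_sub j4 icu, integral_add j3 (iuf.const_mul 2),
      integral_sub j2 (ifφ.const_mul (2 * c)), integral_sub j1 (iu.const_mul (2 * c)),
      integral_const_mul, integral_const_mul, integral_const_mul, integral_const_mul,
      hφint, hfint, ← hI, ← hJ, hc]
    field_simp
    ring
  have hle : ∫ x in Ioo (0:ℝ) s, (c + -u x) ^ 2 * φ x ≤ 0 := by
    rw [e3] at hmain
    have : α * (T - 2 / α * (J - m * I)) = α * T - 2 * (J - m * I) := by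
      field_simp
    linarith
  have hnn : 0 ≤ᵐ[volume.restrict (Ioo (0:ℝ) s)] fun x => (c + -u x) ^ 2 * φ x := by
    filter_upwards [ae_restrict_mem measurableSet_Ioo] with x hx
    exact mul_nonneg (sq_nonneg _) (hφ0 x (hsub hx))
  have hz := (setIntegral_eq_zero_iff_of_nonneg_ae hnn icu).1
    (le_antisymm hle (integral_nonneg_of_ae hnn))
  refine ⟨s, hs, c, ?_⟩
  filter_upwards [hz, ae_restrict_mem measurableSet_Ioo] with x hx hxs
  have := (mul_eq_zero.1 hx).resolve_right (hφp x (hsub hxs)).ne'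
  linarith [pow_eq_zero_iff two_ne_zero |>.1 this]

/-- If `β > 1`, the minimizer is unbounded near `0`. -/
lemma eLpNorm_top_eq_top {φ f u : ℝ → ℝ} {α β D δ₀ ε : ℝ} (hα : 0 < α)
    (hβD : 2 * β < D) (hβ : 1 < β) (hδ₀ : δ₀ ∈ Ioo (0:ℝ) 1) (hφ : ∀ r, φ r = r ^ (D - 1))
    (hfpow : ∀ r ∈ Ioo (0:ℝ) δ₀, f r = r ^ (-β)) (hf : MemL2w φ f)
    (hu : IsEROFMinimizer φ φ f α u) (hε : ε ∈ Ioo (0:ℝ) 1) :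
    eLpNorm u ⊤ (volume.restrict (Ioo (0:ℝ) ε)) = ⊤ := by
  have hφm : Measurable φ := by
    rw [funext hφ]
    fun_prop
  have hφ0 : ∀ x ∈ Ioo (0:ℝ) 1, 0 ≤ φ x := fun x hx => by
    rw [hφ]
    exact Real.rpow_nonneg hx.1.le _
  have hDβ : 0 < D - β := by linarith
  by_contra hne
  rw [eLpNorm_exponent_top] at hne
  set M := (eLpNormEssSup u (volume.restrict (Ioo (0:ℝ) ε))).toReal with hM
  have hM0 : 0 ≤ M := ENNReal.toReal_nonneg
  have hbd : ∀ᵐ x ∂(volume.restrict (Ioo (0:ℝ) ε)), u x ≤ M := by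
    filter_upwards [ae_le_eLpNormEssSup (f := u)] with x hx
    have := ENNReal.toReal_mono hne hx
    rw [toReal_enorm] at this
    exact (le_abs_self _).trans this
  obtain ⟨T, hT, hvar⟩ := variation_inequality hα (by linarith) hφ hf hu
  have hone : MemL2w φ (fun _ => 1) := memL2w_const hφ (by linarith) 1
  have key : ∀ s, 0 < s → s < min ε δ₀ → s ^ (1 - β) ≤ (D - β) / 2 * (2 * M + 1 + α) := by
    intro s hs0 hsm
    have hsε : s < ε := hsm.trans_le (min_le_left _ _)
    have hsδ : s < δ₀ := hsm.trans_le (min_le_right _ _)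
    have hs : s ∈ Ioo (0:ℝ) 1 := ⟨hs0, hsε.trans hε.2⟩
    have hsub : Ioo (0:ℝ) s ⊆ Ioo (0:ℝ) 1 := Ioo_subset_Ioo_right hs.2.le
    have h := hvar s hs (fun _ => 1) (T + φ s) hone fun z hz => by
      simp only [one_mul]
      rw [admissible_integral_deriv hz hs0.le]
      exact add_le_add (hT z hz) ((le_abs_self _).trans (hz.2.2.2 s hs))
    have iu : IntegrableOn (fun x => u x * φ x) (Ioo (0:ℝ) s) := by
      simpa using (hu.1.integrableOn_mul hφm hφ0 hone).mono_set hsub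
    have ifφ : IntegrableOn (fun x => f x * φ x) (Ioo (0:ℝ) s) := by
      simpa using (hf.integrableOn_mul hφm hφ0 hone).mono_set hsub
    have iφ : IntegrableOn φ (Ioo (0:ℝ) s) := by
      simpa using (hone.integrableOn_mul hφm hφ0 hone).mono_set hsub
    have hφint : ∫ x in Ioo (0:ℝ) s, φ x = s ^ D / D := by
      rw [funext hφ, setIntegral_rpow (by linarith) hs0.le]
    have hfint : ∫ x in Ioo (0:ℝ) s, f x * φ x = s ^ (D - β) / (D - β) := by
      rw [← setIntegral_rpow hDβ hs0.le]
      refine setIntegral_congr_fun measurableSet_Ioo fun x hx => ?_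
      simp only [hφ]
      rw [hfpow x ⟨hx.1, hx.2.trans hsδ⟩, ← Real.rpow_add hx.1]
      congr 1
      ring
    have huint : ∫ x in Ioo (0:ℝ) s, u x * φ x ≤ M * (s ^ D / D) := by
      rw [← hφint, ← integral_const_mul]
      refine integral_mono_ae iu (iφ.const_mul M) ?_
      filter_upwards [ae_restrict_of_ae_restrict_of_subset (Ioo_subset_Ioo_right hsε.le) hbd,
        ae_restrict_mem measurableSet_Ioo] with x hx hxs
      exact mul_le_mul_of_nonneg_right hx (hφ0 x (hsub hxs))
    have e : ∫ x in Ioo (0:ℝ) s, (2 * (u x - f x) * 1 + 1 ^ 2) * φ x =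
        2 * (∫ x in Ioo (0:ℝ) s, u x * φ x) - 2 * (s ^ (D - β) / (D - β)) + s ^ D / D := by
      have e' : ∀ x, (2 * (u x - f x) * 1 + 1 ^ 2) * φ x =
          2 * (u x * φ x) - 2 * (f x * φ x) + φ x := fun x => by ring
      simp only [e']
      have j : IntegrableOn (fun x => 2 * (u x * φ x) - 2 * (f x * φ x)) (Ioo (0:ℝ) s) :=
        (iu.const_mul 2).sub (ifφ.const_mul 2)
      rw [integral_add j iφ, integral_sub (iu.const_mul 2) (ifφ.const_mul 2),
        integral_const_mul, integral_const_mul, hφint, hfint]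
    rw [e, hφ] at h
    have hp : 0 < s ^ (D - 1) := Real.rpow_pos_of_pos hs0 _
    have hsD : s ^ D / D ≤ s ^ (D - 1) := by
      have : s ^ D = s ^ (D - 1) * s := by
        rw [← Real.rpow_add_one hs0.ne']
        congr 1
        ring
      rw [this, div_le_iff₀ (by linarith)]
      have := hs.2
      gcongr
      linarith
    have hsDβ : s ^ (D - β) = s ^ (D - 1) * s ^ (1 - β) := by
      rw [← Real.rpow_add hs0]
      congr 1
      ring
    have h2 : 2 * (s ^ (D - β) / (D - β)) ≤ (2 * M + 1 + α) * s ^ (D - 1) := by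
      nlinarith
    rw [hsDβ, ← mul_div_assoc, div_le_iff₀ hDβ] at h2
    have h3 : s ^ (D - 1) * s ^ (1 - β) ≤ s ^ (D - 1) * ((D - β) / 2 * (2 * M + 1 + α)) := by
      linarith
    exact le_of_mul_le_mul_left h3 hp
  have hlim := tendsto_rpow_neg_nhdsGT_zero (y := 1 - β) (by linarith)
  obtain ⟨s, h1, h2⟩ := ((hlim.eventually_gt_atTop ((D - β) / 2 * (2 * M + 1 + α))).and
    (Ioo_mem_nhdsGT (lt_min hε.1 hδ₀.1))).exists
  exact absurd (key s h2.1 h2.2) (not_le.2 h1)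

/-- Lemma `boundconditions`.  Let `f : (0,1) → ℝ` be in `L²(δ,1)` for
each `δ ∈ (0,1)` and equal to `r^{−β}` on `(0,δ₀)` with `2β < d`, so that
`f ∈ L²_{r^{d−1}}(0,1)`, and let `u` be the minimizer of the weighted ROF problem with
weights `ρ(r) = φ(r) = r^{d−1}`.  Then: if `u` is unbounded on every neighborhood of `0`
then necessarily `β ≥ 1`; if `β > 1` then `u` is unbounded on every neighborhood of `0`;
and if `d = 2` then `u` is bounded on a neighborhood of `0`. -/
theorem statement_13
    (d : ℕ) (hd : 2 ≤ d) (β δ₀ α : ℝ) (hδ₀ : δ₀ ∈ Set.Ioo (0:ℝ) 1) (hα : 0 < α)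
    (φ : ℝ → ℝ) (hφ : ∀ r : ℝ, φ r = r ^ ((d : ℝ) - 1))
    (f : ℝ → ℝ)
    (hfloc : ∀ δ ∈ Set.Ioo (0:ℝ) 1, IntegrableOn (fun r => f r ^ 2) (Set.Ioo δ 1))
    (hfpow : ∀ r ∈ Set.Ioo (0:ℝ) δ₀, f r = r ^ (-β))
    (hβd : 2 * β < d) (hfL2 : MemL2w φ f)
    (u : ℝ → ℝ) (hu : IsEROFMinimizer φ φ f α u) :
    ((∀ ε ∈ Set.Ioo (0:ℝ) 1, eLpNorm u ⊤ (volume.restrict (Set.Ioo (0:ℝ) ε)) = ⊤) →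
      1 ≤ β) ∧
    (1 < β →
      ∀ ε ∈ Set.Ioo (0:ℝ) 1, eLpNorm u ⊤ (volume.restrict (Set.Ioo (0:ℝ) ε)) = ⊤) ∧
    (d = 2 →
      ∃ ε ∈ Set.Ioo (0:ℝ) 1, eLpNorm u ⊤ (volume.restrict (Set.Ioo (0:ℝ) ε)) < ⊤) := by
  have hD : (2:ℝ) ≤ d := by exact_mod_cast hd
  have hbdd : β < 1 →
      ∃ ε ∈ Set.Ioo (0:ℝ) 1, eLpNorm u ⊤ (volume.restrict (Set.Ioo (0:ℝ) ε)) < ⊤ := by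
    intro hβ
    obtain ⟨s, hs, c, hc⟩ := exists_ae_eq_const hα hD hβd hβ hδ₀ hφ hfpow hfL2 hu
    refine ⟨s, hs, ?_⟩
    rw [eLpNorm_exponent_top]
    refine eLpNormEssSup_lt_top_of_ae_bound (C := |c|) ?_
    filter_upwards [hc] with x hx
    rw [hx, Real.norm_eq_abs]
  refine ⟨fun h => ?_, fun hβ ε hε =>
    eLpNorm_top_eq_top hα hβd hβ hδ₀ hφ hfpow hfL2 hu hε, fun h2 => hbdd ?_⟩
  · by_contra hβ
    obtain ⟨ε, hε, hlt⟩ := hbdd (not_le.1 hβ)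
    exact hlt.ne (h ε hε)
  · rw [h2] at hβd
    push_cast at hβd
    linarith
end
end
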